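/- arXiv:0902.2238 — 2 statements merged into one kernel-verified Lean document; each statement's English description precedes it below -/
import Mathlib

section
/- Let F be a finite field with exactly q elements and n ≥ 1. Then for every g ∈ GL(n,F), the order of the centralizer of g in GL(n,F) is at least q^n · (1 − 1/q) / (e · (1 + log(n+1)/log(q))), where e is Euler's number and log is the natural logarithm. -/
open Polynomial Finset

section Counting

/-- A linear functional `θ` and a vector `v` with `1 + θ v` a unit give the automorphism
`w ↦ w + θ w • v`. -/
def unitOfFunctional {A V : Type*} [CommRing A] [AddCommGroup V] [Module A V]
    (θ : V →ₗ[A] A) (v : V) (u : Aˣ) (h : 1 + θ v = u) : (Module.End A V)ˣ where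
  val := 1 + θ.smulRight v
  inv := 1 - (((u⁻¹ : Aˣ) : A) • θ).smulRight v
  val_inv := by
    ext w
    have h1 : ((u⁻¹ : Aˣ) : A) * (1 + θ v) = 1 := by rw [h, Units.inv_mul]
    simp only [Module.End.mul_apply, LinearMap.add_apply, LinearMap.sub_apply,
      Module.End.one_apply, LinearMap.smulRight_apply, LinearMap.smul_apply, map_sub, map_smul,
      smul_eq_mul]
    match_scalars
    · ring
    · linear_combination (-θ w) * h1
  inv_val := by
    ext w
    have h1 : ((u⁻¹ : Aˣ) : A) * (1 + θ v) = 1 := by rw [h, Units.inv_mul]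
    simp only [Module.End.mul_apply, LinearMap.add_apply, LinearMap.sub_apply,
      Module.End.one_apply, LinearMap.smulRight_apply, LinearMap.smul_apply, map_add, map_smul,
      smul_eq_mul]
    match_scalars
    · ring
    · linear_combination (-θ w) * h1

theorem card_hom_mul_card_units_le {A V : Type*} [CommRing A] [Finite A] [AddCommGroup V]
    [Finite V] [Module A V] (v : V) (ψ : V →ₗ[A] A) (hψ : ψ v = 1) :
    Nat.card (V →ₗ[A] A) * Nat.card Aˣ ≤ Nat.card (Module.End A V)ˣ * Nat.card A := by
  have : Finite (Module.End A V) := Finite.of_injective _ DFunLike.coe_injective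
  rw [← Nat.card_prod, ← Nat.card_prod]
  refine Nat.card_le_card_of_injective (fun x ↦ (unitOfFunctional
    (x.1 + ((x.2 : A) - x.1 v) • ψ - ψ) v x.2 (by simp [hψ]), x.1 v)) ?_
  rintro ⟨φ, u⟩ ⟨φ', u'⟩ h
  rw [Prod.mk.injEq, Units.ext_iff] at h
  obtain ⟨h, hv⟩ := h
  have key (w : V) : φ w + ((u : A) - φ v) * ψ w = φ' w + ((u' : A) - φ' v) * ψ w := by
    have := congrArg ψ (LinearMap.congr_fun h w)
    simpa [unitOfFunctional, hψ] using this
  have hu : (u : A) = u' := by simpa [hψ] using key v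
  refine Prod.ext (LinearMap.ext fun w ↦ ?_) (Units.ext hu)
  simpa [hu, hv] using key w

theorem card_mul_prod_card_units_quotient_le (A : Type*) [CommRing A] [Finite A]
    [Fintype (MaximalSpectrum A)] :
    Nat.card A * ∏ m : MaximalSpectrum A, Nat.card (A ⧸ m.asIdeal)ˣ ≤
      Nat.card Aˣ * ∏ m : MaximalSpectrum A, Nat.card (A ⧸ m.asIdeal) := by
  let π : A →+* ∀ m : MaximalSpectrum A, A ⧸ m.asIdeal := RingHom.pi fun m ↦ Ideal.Quotient.mk _
  have hπ : Function.Surjective π := fun x ↦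
    (Ideal.pi_quotient_surjective (I := fun m : MaximalSpectrum A ↦ m.asIdeal)
      (fun I J h ↦ MaximalSpectrum.isCoprime_of_ne h) x).imp fun _ h ↦ funext h
  have hcard : Nat.card A = Nat.card (RingHom.ker π) *
      ∏ m : MaximalSpectrum A, Nat.card (A ⧸ m.asIdeal) := by
    rw [← Nat.card_pi, ← Nat.card_congr (RingHom.quotientKerEquivOfSurjective hπ).toEquiv]
    exact Submodule.card_eq_card_quotient_mul_card _
  rw [hcard, mul_right_comm]
  refine Nat.mul_le_mul_right _ ?_
  rw [← Nat.card_pi, ← Nat.card_prod]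
  have hunit (x : RingHom.ker π × ∀ m : MaximalSpectrum A, (A ⧸ m.asIdeal)ˣ) :
      IsUnit (Function.surjInv hπ (fun m ↦ (x.2 m : A ⧸ m.asIdeal)) + x.1) := by
    by_contra hx
    obtain ⟨m, hm, hxm⟩ := exists_max_ideal_of_mem_nonunits hx
    have h := Function.surjInv_eq hπ (fun m ↦ (x.2 m : A ⧸ m.asIdeal))
    have h1 : π (x.1 : A) = 0 := x.1.2
    have h2 := congrFun (congrArg₂ (· + ·) h h1) ⟨m, hm⟩
    rw [← map_add] at h2
    have h3 : π (Function.surjInv hπ (fun m ↦ (x.2 m : A ⧸ m.asIdeal)) + x.1) ⟨m, hm⟩ = 0 :=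
      Ideal.Quotient.eq_zero_iff_mem.2 hxm
    rw [h3] at h2
    have : Nontrivial (A ⧸ m) := Ideal.Quotient.nontrivial_iff.2 hm.ne_top
    exact (x.2 ⟨m, hm⟩).ne_zero (by simpa using h2.symm)
  refine Nat.card_le_card_of_injective (fun x ↦ (hunit x).unit) ?_
  rintro ⟨k, y⟩ ⟨k', y'⟩ h
  have h' : Function.surjInv hπ (fun m ↦ (y m : A ⧸ m.asIdeal)) + k =
      Function.surjInv hπ (fun m ↦ (y' m : A ⧸ m.asIdeal)) + k' := congrArg Units.val h
  have hk : π (k : A) = 0 := k.2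
  have hk' : π (k' : A) = 0 := k'.2
  have hy : y = y' := by
    have := congrArg π h'
    rw [map_add, map_add, hk, hk', Function.surjInv_eq hπ, Function.surjInv_eq hπ, add_zero,
      add_zero] at this
    exact funext fun m ↦ Units.ext (congrFun this m)
  subst hy
  exact Prod.ext (Subtype.ext (add_left_cancel h')) rfl

end Counting

section Frobenius

variable {F A V : Type*} [Field F] [CommRing A] [Algebra F A] [AddCommGroup V] [Module F V]
  [Module A V] [IsScalarTower F A V]

theorem PowerBasis.exists_nondegenerate_functional [Nontrivial A] (pb : PowerBasis F A) :
    ∃ ε : A →ₗ[F] F, ∀ a, (∀ b, ε (a * b) = 0) → a = 0 := by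
  have hd := pb.dim_pos
  refine ⟨pb.basis.coord ⟨pb.dim - 1, by omega⟩, fun a ha ↦ ?_⟩
  obtain ⟨p, hp, rfl⟩ := pb.exists_eq_aeval a
  by_contra h0
  have hp0 : p ≠ 0 := by rintro rfl; simp at h0
  have h := ha (pb.gen ^ (pb.dim - 1 - p.natDegree))
  have hcoord (i : ℕ) (hi : i < pb.dim) :
      pb.basis.coord ⟨pb.dim - 1, by omega⟩ (pb.gen ^ i) = if i = pb.dim - 1 then 1 else 0 := by
    have := pb.basis_eq_pow ⟨i, hi⟩
    simp only at this
    rw [← this, Module.Basis.coord_apply, Module.Basis.repr_self, Finsupp.single_apply]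
    simp
  rw [aeval_eq_sum_range, Finset.sum_mul, map_sum, Finset.sum_eq_single p.natDegree] at h
  · rw [smul_mul_assoc, ← pow_add, map_smul, hcoord _ (by omega), if_pos (by omega)] at h
    simp [hp0] at h
  · intro i hi hne
    rw [Finset.mem_range] at hi
    rw [smul_mul_assoc, ← pow_add, map_smul, hcoord _ (by omega), if_neg (by omega), smul_zero]
  · simp

theorem exists_hom_of_functional [Module.Finite F A] {ε : A →ₗ[F] F}
    (hε : ∀ a, (∀ b, ε (a * b) = 0) → a = 0) (l : V →ₗ[F] F) :
    ∃ ψ : V →ₗ[A] A, ∀ w, ε (ψ w) = l w := by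
  let Φ : A →ₗ[F] Module.Dual F A := (LinearMap.mul F A).compr₂ ε
  have hΦ (a b : A) : Φ a b = ε (a * b) := rfl
  have hinj : Function.Injective Φ := (injective_iff_map_eq_zero Φ).2 fun a ha ↦
    hε a fun b ↦ by rw [← hΦ, ha]; rfl
  have hsurj : Function.Surjective Φ :=
    (LinearMap.injective_iff_surjective_of_finrank_eq_finrank
      (Subspace.dual_finrank_eq (K := F) (V := A)).symm).1 hinj
  choose ψ hψ using fun w : V ↦
    hsurj (l ∘ₗ (LinearMap.toSpanSingleton A V w).restrictScalars F)
  have hψ' (w : V) (b : A) : ε (ψ w * b) = l (b • w) := by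
    rw [← hΦ, hψ]; rfl
  refine ⟨⟨⟨ψ, fun x y ↦ hinj ?_⟩, fun a x ↦ hinj ?_⟩, fun w ↦ by simpa using hψ' w 1⟩
  · ext b
    simp [hΦ, hψ']
  · ext b
    rw [hΦ, hψ', hΦ, RingHom.id_apply, smul_eq_mul, mul_comm a, mul_assoc, hψ', smul_smul,
      mul_comm]

theorem exists_smul_injective [Module.Finite F V] [FaithfulSMul A V] (a : A)
    (ha : Function.Surjective (aeval (R := F) a)) :
    ∃ v : V, Function.Injective fun b : A ↦ b • v := by
  let _ : Module F[X] V := Module.compHom V (aeval (R := F) a).toRingHom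
  have hsm (p : F[X]) (w : V) : p • w = aeval a p • w := rfl
  have : IsScalarTower F F[X] V := ⟨fun c p w ↦ by simp [hsm]⟩
  have : Module.Finite F[X] V := Module.Finite.of_restrictScalars_finite F F[X] V
  obtain ⟨v, hv⟩ := Module.exists_ker_toSpanSingleton_eq_annihilator F[X] V
  refine ⟨v, fun b c hbc ↦ ?_⟩
  obtain ⟨p, hp⟩ := ha (b - c)
  have hp' : p ∈ LinearMap.ker (LinearMap.toSpanSingleton F[X] V v) := by
    rw [LinearMap.mem_ker, LinearMap.toSpanSingleton_apply, hsm, hp, sub_smul, sub_eq_zero]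
    exact hbc
  rw [hv, Module.mem_annihilator] at hp'
  refine FaithfulSMul.eq_of_smul_eq_smul (α := V) fun w ↦ ?_
  rw [← sub_eq_zero, ← sub_smul, ← hp, ← hsm, hp']

theorem exists_functional_eq_one [Module.Finite F A] {ε : A →ₗ[F] F}
    (hε : ∀ a, (∀ b, ε (a * b) = 0) → a = 0) (v : V)
    (hv : Function.Injective fun b : A ↦ b • v) : ∃ ψ : V →ₗ[A] A, ψ v = 1 := by
  obtain ⟨r, hr⟩ := LinearMap.exists_leftInverse_of_injective
    ((LinearMap.toSpanSingleton A V v).restrictScalars F) (LinearMap.ker_eq_bot.2 hv)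
  obtain ⟨ψ, hψ⟩ := exists_hom_of_functional hε (ε ∘ₗ r)
  refine ⟨ψ, sub_eq_zero.1 (hε _ fun b ↦ ?_)⟩
  have h1 : r (b • v) = b := LinearMap.congr_fun hr b
  have h2 := hψ (b • v)
  rw [map_smul, smul_eq_mul, LinearMap.comp_apply, h1] at h2
  rw [sub_mul, one_mul, map_sub, mul_comm, h2, sub_self]

theorem card_pow_finrank_mul_card_units_le [Finite F] [Module.Finite F V] [FaithfulSMul A V]
    [Nontrivial A] (pb : PowerBasis F A) :
    Nat.card F ^ Module.finrank F V * Nat.card Aˣ ≤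
      Nat.card (Module.End A V)ˣ * Nat.card A := by
  have := pb.finite
  have : Finite A := Module.finite_of_finite F
  have : Finite V := Module.finite_of_finite F
  have : Finite (V →ₗ[A] A) := Finite.of_injective _ DFunLike.coe_injective
  obtain ⟨ε, hε⟩ := pb.exists_nondegenerate_functional
  obtain ⟨v, hv⟩ := exists_smul_injective (V := V) (F := F) pb.gen fun y ↦
    (pb.exists_eq_aeval' y).imp fun _ h ↦ h.symm
  obtain ⟨ψ, hψ⟩ := exists_functional_eq_one hε v hv
  refine le_trans (Nat.mul_le_mul_right _ ?_) (card_hom_mul_card_units_le v ψ hψ)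
  rw [← Subspace.dual_finrank_eq, ← Module.natCard_eq_pow_finrank]
  choose Ψ hΨ using fun l : Module.Dual F V ↦ exists_hom_of_functional (A := A) hε l
  refine Nat.card_le_card_of_injective Ψ fun l l' h ↦ LinearMap.ext fun w ↦ ?_
  rw [← hΨ l, ← hΨ l', h]

end Frobenius

section Degrees

variable {F A : Type*} [Field F] [CommRing A] [Algebra F A]

theorem mkₐ_pi_surjective (S : Finset (MaximalSpectrum A)) :
    Function.Surjective (AlgHom.pi fun m : S ↦ Ideal.Quotient.mkₐ F m.1.asIdeal) := fun x ↦
  (Ideal.pi_quotient_surjective (I := fun m : S ↦ m.1.asIdeal)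
    (fun _ _ h ↦ MaximalSpectrum.isCoprime_of_ne fun e ↦ h (Subtype.ext e)) x).imp
      fun _ h ↦ funext h

variable [Module.Finite F A]

theorem sum_finrank_quotient_eq (S : Finset (MaximalSpectrum A)) :
    ∑ m ∈ S, Module.finrank F (A ⧸ m.asIdeal) =
      Module.finrank F (∀ m : S, A ⧸ m.1.asIdeal) := by
  rw [Module.finrank_pi_fintype, Finset.sum_coe_sort S fun m ↦ Module.finrank F (A ⧸ m.asIdeal)]

theorem sum_finrank_quotient_le (S : Finset (MaximalSpectrum A)) :
    ∑ m ∈ S, Module.finrank F (A ⧸ m.asIdeal) ≤ Module.finrank F A := by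
  rw [sum_finrank_quotient_eq]
  exact LinearMap.finrank_le_finrank_of_surjective
    (f := (AlgHom.pi fun m : S ↦ Ideal.Quotient.mkₐ F m.1.asIdeal).toLinearMap)
    (mkₐ_pi_surjective (F := F) S)

theorem mul_card_filter_finrank_le [Finite F] {a : A} (ha : IsUnit a)
    (hsurj : Function.Surjective (aeval (R := F) a)) (S : Finset (MaximalSpectrum A)) {d : ℕ}
    (hd : d ≠ 0) (hS : ∀ m ∈ S, Module.finrank F (A ⧸ m.asIdeal) = d) :
    d * #S ≤ Nat.card F ^ d - 1 := by
  have hq : 1 < Nat.card F ^ d := Nat.one_lt_pow hd Finite.one_lt_card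
  let P : F[X] := X ^ (Nat.card F ^ d - 1) - C 1
  have hP : P ≠ 0 := X_pow_sub_C_ne_zero (by omega) 1
  let π : A →ₐ[F] ∀ m : S, A ⧸ m.1.asIdeal := AlgHom.pi fun m : S ↦ Ideal.Quotient.mkₐ F _
  have hroot : aeval (π a) P = 0 := by
    simp only [P, map_sub, map_pow, aeval_X, map_one, sub_eq_zero]
    funext m
    let _ := Ideal.Quotient.field m.1.asIdeal
    have : Finite (A ⧸ m.1.asIdeal) := Module.finite_of_finite F
    have : Fintype (A ⧸ m.1.asIdeal) := Fintype.ofFinite _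
    have h1 : Ideal.Quotient.mk m.1.asIdeal a ≠ 0 := (ha.map _).ne_zero
    have h2 := FiniteField.pow_card_sub_one_eq_one _ h1
    rw [← Nat.card_eq_fintype_card, Module.natCard_eq_pow_finrank (K := F), hS _ m.2] at h2
    exact h2
  let f : AdjoinRoot P →ₐ[F] ∀ m : S, A ⧸ m.1.asIdeal :=
    AdjoinRoot.liftAlgHom P (Algebra.ofId F _) (π a) hroot
  have hs : Function.Surjective f := by
    intro y
    obtain ⟨x, rfl⟩ := mkₐ_pi_surjective (F := F) S y
    obtain ⟨p, rfl⟩ := hsurj x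
    exact ⟨AdjoinRoot.mk P p, aeval_algHom_apply π a p⟩
  have : Module.Finite F (AdjoinRoot P) := (AdjoinRoot.powerBasis hP).finite
  have h := LinearMap.finrank_le_finrank_of_surjective (f := f.toLinearMap) hs
  rw [← sum_finrank_quotient_eq, Finset.sum_congr rfl hS, (AdjoinRoot.powerBasis hP).finrank,
    AdjoinRoot.powerBasis_dim, natDegree_X_pow_sub_C, sum_const, smul_eq_mul, mul_comm] at h
  exact h

end Degrees

section Estimates

variable {ι : Type*} [Fintype ι] {q n M : ℕ} {d : ι → ℕ}

theorem sum_inv_pow_sub_one_le_harmonic (hq : 1 < q) (hM : 1 ≤ M) (hnM : n + 1 ≤ q ^ M)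
    (hd : ∀ i, 1 ≤ d i) (hsum : ∑ i, d i ≤ n)
    (hcount : ∀ k, 1 ≤ k → k * #{i | d i = k} ≤ q ^ k - 1) :
    ∑ i, ((q : ℝ) ^ d i - 1)⁻¹ ≤ harmonic M := by
  have hq' : (1 : ℝ) < q := by exact_mod_cast hq
  have hpos (k : ℕ) (hk : 1 ≤ k) : (0 : ℝ) < (q : ℝ) ^ k - 1 :=
    sub_pos.2 (one_lt_pow₀ hq' (by omega))
  obtain ⟨m, rfl⟩ : ∃ m, M = m + 1 := ⟨M - 1, by omega⟩
  rw [harmonic_succ, Rat.cast_add, ← Finset.sum_filter_add_sum_filter_not univ (d · ≤ m)]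
  refine add_le_add ?_ ?_
  · rw [harmonic_eq_sum_Icc, Rat.cast_sum,
      ← Finset.sum_fiberwise_of_maps_to (t := Icc 1 m) (g := d)
        (fun i hi ↦ mem_Icc.2 ⟨hd i, (mem_filter.1 hi).2⟩)]
    refine Finset.sum_le_sum fun k hk ↦ ?_
    have hk1 := (mem_Icc.1 hk).1
    have hkpos : (0 : ℝ) < k := by exact_mod_cast hk1
    calc ∑ i ∈ {i ∈ {i | d i ≤ m} | d i = k}, ((q : ℝ) ^ d i - 1)⁻¹
        = #{i ∈ {i | d i ≤ m} | d i = k} * ((q : ℝ) ^ k - 1)⁻¹ := by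
          rw [← nsmul_eq_mul, ← Finset.sum_const]
          exact Finset.sum_congr rfl fun i hi ↦ by rw [(mem_filter.1 hi).2]
      _ ≤ #{i | d i = k} * ((q : ℝ) ^ k - 1)⁻¹ := by
          have := (hpos k hk1).le
          gcongr
          simp
      _ ≤ ((k⁻¹ : ℚ) : ℝ) := by
          have h := hcount k hk1
          have h' : (k : ℝ) * #{i | d i = k} ≤ (q : ℝ) ^ k - 1 := by
            rw [← Nat.cast_pow, ← Nat.cast_one, ← Nat.cast_sub (Nat.one_le_pow _ _ (by omega))]
            exact_mod_cast h
          push_cast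
          rw [← div_eq_mul_inv, div_le_iff₀ (hpos k hk1), ← div_eq_inv_mul, le_div_iff₀ hkpos]
          linarith
  · have hMpos : (0 : ℝ) < (m + 1 : ℕ) := by positivity
    have hp := hpos (m + 1) hM
    have hsum' : ∑ i, (d i : ℝ) ≤ (q : ℝ) ^ (m + 1) - 1 := by
      have : ((∑ i, d i : ℕ) : ℝ) + 1 ≤ (q : ℝ) ^ (m + 1) := by
        exact_mod_cast (Nat.add_le_add_right hsum 1).trans hnM
      push_cast at this
      linarith
    calc ∑ i with ¬ d i ≤ m, ((q : ℝ) ^ d i - 1)⁻¹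
        ≤ ∑ i with ¬ d i ≤ m, (d i : ℝ) * (((m + 1 : ℕ) : ℝ) * ((q : ℝ) ^ (m + 1) - 1))⁻¹ := by
          refine Finset.sum_le_sum fun i hi ↦ ?_
          have hi' : m + 1 ≤ d i := by simpa using (mem_filter.1 hi).2
          have h1 : (((m + 1 : ℕ) : ℝ)) ≤ d i := by exact_mod_cast hi'
          have h2 : (q : ℝ) ^ (m + 1) ≤ (q : ℝ) ^ d i := pow_le_pow_right₀ hq'.le hi'
          rw [← div_eq_mul_inv, inv_eq_one_div, div_le_div_iff₀ (by linarith) (by positivity),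
            one_mul]
          gcongr
      _ ≤ ∑ i, (d i : ℝ) * (((m + 1 : ℕ) : ℝ) * ((q : ℝ) ^ (m + 1) - 1))⁻¹ :=
          Finset.sum_le_sum_of_subset_of_nonneg (filter_subset _ _) fun i _ _ ↦ by positivity
      _ ≤ (((m + 1 : ℕ) : ℚ)⁻¹ : ℚ) := by
          rw [← Finset.sum_mul, ← div_eq_mul_inv, div_le_iff₀ (by positivity)]
          push_cast at hMpos ⊢
          rw [inv_mul_cancel_left₀ hMpos.ne']
          exact hsum'

theorem inv_exp_mul_le_prod_one_sub (hq : 1 < q) (hM : 1 ≤ M) (hnM : n + 1 ≤ q ^ M)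
    (hd : ∀ i, 1 ≤ d i) (hsum : ∑ i, d i ≤ n)
    (hcount : ∀ k, 1 ≤ k → k * #{i | d i = k} ≤ q ^ k - 1) :
    (Real.exp 1 * M)⁻¹ ≤ ∏ i, (1 - ((q : ℝ) ^ d i)⁻¹) := by
  have hq' : (1 : ℝ) < q := by exact_mod_cast hq
  have hM' : (0 : ℝ) < M := by exact_mod_cast hM
  calc (Real.exp 1 * M)⁻¹ = Real.exp (-(1 + Real.log M)) := by
        rw [Real.exp_neg, Real.exp_add, Real.exp_log hM']
    _ ≤ Real.exp (∑ i, -((q : ℝ) ^ d i - 1)⁻¹) := by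
        rw [Real.exp_le_exp, Finset.sum_neg_distrib, neg_le_neg_iff]
        exact (sum_inv_pow_sub_one_le_harmonic hq hM hnM hd hsum hcount).trans
          (harmonic_le_one_add_log M)
    _ = ∏ i, Real.exp (-((q : ℝ) ^ d i - 1)⁻¹) := Real.exp_sum _ _
    _ ≤ ∏ i, (1 - ((q : ℝ) ^ d i)⁻¹) := by
        refine Finset.prod_le_prod (fun i _ ↦ (Real.exp_pos _).le) fun i _ ↦ ?_
        have hx : 1 < (q : ℝ) ^ d i := one_lt_pow₀ hq' (by have := hd i; omega)
        have hx' : 0 < (q : ℝ) ^ d i - 1 := by linarith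
        have h := Real.add_one_le_exp (((q : ℝ) ^ d i - 1)⁻¹)
        rw [Real.exp_neg]
        refine (inv_anti₀ (by positivity) h).trans_eq ?_
        field_simp
        ring

end Estimates

theorem card_le_exp_mul_clog_mul_card_units {F A : Type*} [Field F] [Finite F] [CommRing A]
    [Algebra F A] [Module.Finite F A] {a : A} (ha : IsUnit a)
    (hsurj : Function.Surjective (aeval (R := F) a)) {n : ℕ} (hn : 1 ≤ n)
    (hA : Module.finrank F A ≤ n) :
    (Nat.card A : ℝ) ≤ Real.exp 1 * Nat.clog (Nat.card F) (n + 1) * Nat.card Aˣ := by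
  have hq : 1 < Nat.card F := Finite.one_lt_card
  have : Finite A := Module.finite_of_finite F
  have : Fintype (MaximalSpectrum A) := Fintype.ofFinite _
  have hM : 1 ≤ Nat.clog (Nat.card F) (n + 1) := Nat.clog_pos hq (by omega)
  have hcard (m : MaximalSpectrum A) :
      (Nat.card (A ⧸ m.asIdeal) : ℝ) =
        (Nat.card F : ℝ) ^ Module.finrank F (A ⧸ m.asIdeal) := by
    exact_mod_cast Module.natCard_eq_pow_finrank
  have (m : MaximalSpectrum A) : Finite (A ⧸ m.asIdeal) :=
    Finite.of_surjective _ Ideal.Quotient.mk_surjective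
  have hpos (m : MaximalSpectrum A) : (0 : ℝ) < Nat.card (A ⧸ m.asIdeal) := by
    exact_mod_cast Nat.card_pos
  have hprod := inv_exp_mul_le_prod_one_sub hq hM (Nat.le_pow_clog hq (n + 1))
    (d := fun m : MaximalSpectrum A ↦ Module.finrank F (A ⧸ m.asIdeal))
    (fun m ↦ Module.finrank_pos) ((sum_finrank_quotient_le univ).trans hA)
    (fun k hk ↦ mul_card_filter_finrank_le ha hsurj _ (by omega) fun m hm ↦ (mem_filter.1 hm).2)
  have hunits (m : MaximalSpectrum A) : (Nat.card (A ⧸ m.asIdeal)ˣ : ℝ) =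
      Nat.card (A ⧸ m.asIdeal) *
        (1 - ((Nat.card F : ℝ) ^ Module.finrank F (A ⧸ m.asIdeal))⁻¹) := by
    let _ := Ideal.Quotient.field m.asIdeal
    have h : Nat.card (A ⧸ m.asIdeal)ˣ = Nat.card (A ⧸ m.asIdeal) - 1 := Nat.card_units _
    rw [h, ← hcard, mul_sub, mul_one, mul_inv_cancel₀ (hpos m).ne', Nat.cast_sub Nat.card_pos,
      Nat.cast_one]
  have h : (Nat.card A : ℝ) * ∏ m : MaximalSpectrum A, (Nat.card (A ⧸ m.asIdeal)ˣ : ℝ) ≤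
      Nat.card Aˣ * ∏ m : MaximalSpectrum A, (Nat.card (A ⧸ m.asIdeal) : ℝ) := by
    exact_mod_cast card_mul_prod_card_units_quotient_le A
  simp_rw [hunits] at h
  rw [Finset.prod_mul_distrib, mul_left_comm, mul_comm (Nat.card Aˣ : ℝ)] at h
  have h := le_of_mul_le_mul_left h (Finset.prod_pos fun m _ ↦ hpos m)
  have hE : 0 < Real.exp 1 * (Nat.clog (Nat.card F) (n + 1) : ℝ) := by
    have : (0 : ℝ) < Nat.clog (Nat.card F) (n + 1) := by exact_mod_cast hM
    positivity
  have h2 := (mul_le_mul_of_nonneg_left hprod (Nat.cast_nonneg (Nat.card A))).trans h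
  rw [← div_eq_mul_inv, div_le_iff₀ hE] at h2
  linarith

theorem Nat.clog_succ_le_one_add_log_div_log {q n : ℕ} (hq : 1 < q) (hn : 1 ≤ n) :
    (Nat.clog q (n + 1) : ℝ) ≤ 1 + Real.log ((n : ℝ) + 1) / Real.log q := by
  have hq' : (1 : ℝ) < q := by exact_mod_cast hq
  have hM : 1 ≤ Nat.clog q (n + 1) := Nat.clog_pos hq (by omega)
  have h := Nat.pow_pred_clog_lt_self hq (x := n + 1) (by omega)
  have h' : (q : ℝ) ^ (Nat.clog q (n + 1) - 1) ≤ (n : ℝ) + 1 := by exact_mod_cast h.le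
  have h2 := Real.log_le_log (by positivity) h'
  rw [Real.log_pow, Nat.cast_sub hM, Nat.cast_one, ← le_div_iff₀ (Real.log_pos hq')] at h2
  linarith

/-- Automorphisms commuting with an algebra that contains `g` lie in the centralizer of `g`. -/
theorem card_units_end_le_card_centralizer {F A : Type*} [Field F] [Finite F] [CommRing A]
    [Algebra F A] {n : ℕ} [Module A (Fin n → F)] [IsScalarTower F A (Fin n → F)]
    (g : Matrix.GeneralLinearGroup (Fin n) F) (a : A)
    (ha : ∀ w : Fin n → F, a • w = (g : Matrix (Fin n) (Fin n) F).mulVec w) :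
    Nat.card (Module.End A (Fin n → F))ˣ ≤
      Nat.card (Subgroup.centralizer ({g} : Set (Matrix.GeneralLinearGroup (Fin n) F))) := by
  let j : Module.End A (Fin n → F) →* Matrix (Fin n) (Fin n) F :=
    { toFun f := LinearMap.toMatrix' (f.restrictScalars F)
      map_one' := LinearMap.toMatrix'_id
      map_mul' f f' := LinearMap.toMatrix'_comp (f.restrictScalars F) (f'.restrictScalars F) }
  have hj (f : Module.End A (Fin n → F)) (w : Fin n → F) : (j f).mulVec w = f w :=
    LinearMap.toMatrix'_mulVec _ _
  refine Nat.card_le_card_of_injective (fun u ↦ ⟨Units.map j u, ?_⟩) ?_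
  · rw [Subgroup.mem_centralizer_singleton_iff]
    refine Units.ext (Matrix.mulVec_injective (funext fun w ↦ ?_))
    simp only [Units.val_mul, Units.coe_map, ← Matrix.mulVec_mulVec]
    erw [hj, hj]
    rw [← ha, ← ha, map_smul]
  · intro u u' h
    refine Units.ext (LinearMap.ext fun w ↦ ?_)
    have h' : j u = j u' := congrArg (fun x ↦ (x.1 : Matrix (Fin n) (Fin n) F)) h
    rw [← hj, ← hj, h']

/-- Theorem 6.4: every element of `GL(n,q)` has centralizer of order at least
`q^n (1 - 1/q) / (e (1 + log_q (n+1)))`. -/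
theorem stmt_17 (F : Type*) [Field F] [Fintype F] (q n : ℕ)
    (hq : Fintype.card F = q) (hn : 1 ≤ n)
    (g : Matrix.GeneralLinearGroup (Fin n) F) :
    (q : ℝ) ^ n * (1 - 1 / (q : ℝ)) /
        (Real.exp 1 * (1 + Real.log ((n : ℝ) + 1) / Real.log (q : ℝ))) ≤
      (Nat.card (Subgroup.centralizer ({g} : Set (Matrix.GeneralLinearGroup (Fin n) F))) : ℝ) := by
  rw [← Nat.card_eq_fintype_card] at hq
  have hq1 : 1 < q := hq ▸ Finite.one_lt_card
  have hq1' : (1 : ℝ) < q := by exact_mod_cast hq1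
  have : Nonempty (Fin n) := ⟨⟨0, hn⟩⟩
  let T : Module.End F (Fin n → F) := Matrix.toLin' (g : Matrix (Fin n) (Fin n) F)
  have hT : IsUnit T := g.isUnit.map Matrix.toLinAlgEquiv'
  have hf : minpoly F T ≠ 0 := minpoly.ne_zero (Algebra.IsIntegral.isIntegral T)
  let φ : AdjoinRoot (minpoly F T) →ₐ[F] Module.End F (Fin n → F) :=
    Ideal.Quotient.liftₐ _ (aeval T) fun p hp ↦
      Polynomial.aeval_eq_zero_of_dvd_aeval_eq_zero (Ideal.mem_span_singleton.1 hp)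
        (minpoly.aeval F T)
  have hφ (p : F[X]) : φ (AdjoinRoot.mk _ p) = aeval T p := rfl
  have hinj : Function.Injective φ := by
    refine (injective_iff_map_eq_zero φ).2 fun x hx ↦ ?_
    obtain ⟨p, rfl⟩ := AdjoinRoot.mk_surjective x
    rw [hφ] at hx
    exact AdjoinRoot.mk_eq_zero.2 (minpoly.dvd F T hx)
  let _ : Module (AdjoinRoot (minpoly F T)) (Fin n → F) := Module.compHom _ φ.toRingHom
  have hsm (x : AdjoinRoot (minpoly F T)) (w : Fin n → F) : x • w = φ x w := rfl
  have : IsScalarTower F (AdjoinRoot (minpoly F T)) (Fin n → F) :=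
    ⟨fun c x w ↦ by rw [hsm, hsm, map_smul, LinearMap.smul_apply]⟩
  have : FaithfulSMul (AdjoinRoot (minpoly F T)) (Fin n → F) :=
    ⟨fun h ↦ hinj (LinearMap.ext h)⟩
  have : Nontrivial (AdjoinRoot (minpoly F T)) := φ.toRingHom.domain_nontrivial
  let pb := AdjoinRoot.powerBasis hf
  have := pb.finite
  have : Finite (AdjoinRoot (minpoly F T)) := Module.finite_of_finite F
  have hsurj : Function.Surjective (aeval (R := F) pb.gen) := fun y ↦
    (pb.exists_eq_aeval' y).imp fun _ h ↦ h.symm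
  obtain ⟨v, hv⟩ := exists_smul_injective (V := Fin n → F) pb.gen hsurj
  have hdim : Module.finrank F (AdjoinRoot (minpoly F T)) ≤ n := by
    have := LinearMap.finrank_le_finrank_of_injective
      (f := (LinearMap.toSpanSingleton (AdjoinRoot (minpoly F T)) _ v).restrictScalars F) hv
    rwa [Module.finrank_fin_fun] at this
  have hgen : φ pb.gen = T := by
    change φ (AdjoinRoot.mk _ X) = T
    rw [hφ, aeval_X]
  have hunit : IsUnit pb.gen := by
    have hT' : IsUnit (φ pb.gen) := by rw [hgen]; exact hT
    have hreg : Function.Injective fun b ↦ pb.gen * b := fun b c hbc ↦ hinj <|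
      hT'.mul_left_cancel <| by rw [← map_mul, ← map_mul]; exact congrArg φ hbc
    obtain ⟨b, hb⟩ := Finite.injective_iff_surjective.1 hreg 1
    exact .of_mul_eq_one b hb
  have h1 := card_le_exp_mul_clog_mul_card_units hunit hsurj hn hdim
  have h2 := card_pow_finrank_mul_card_units_le (V := Fin n → F) pb
  have h3 := card_units_end_le_card_centralizer g pb.gen fun w ↦ by
    rw [hsm, hgen]; exact Matrix.toLin'_apply _ _
  rw [Module.finrank_fin_fun, hq] at h2
  rw [hq] at h1
  have h4 := Nat.clog_succ_le_one_add_log_div_log hq1 hn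
  set Z := Nat.card (Subgroup.centralizer ({g} : Set (Matrix.GeneralLinearGroup (Fin n) F)))
  set L := 1 + Real.log ((n : ℝ) + 1) / Real.log (q : ℝ)
  have hL : 0 < L := by
    have := Real.log_pos hq1'
    have : 0 ≤ Real.log ((n : ℝ) + 1) := Real.log_nonneg (by simp)
    positivity
  have hU : (0 : ℝ) < Nat.card (AdjoinRoot (minpoly F T))ˣ := by exact_mod_cast Nat.card_pos
  have h5 : (q : ℝ) ^ n * Nat.card (AdjoinRoot (minpoly F T))ˣ ≤
      Z * Nat.card (AdjoinRoot (minpoly F T)) := by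
    exact_mod_cast h2.trans (Nat.mul_le_mul_right _ h3)
  have h6 : (q : ℝ) ^ n ≤ Z * (Real.exp 1 * L) := by
    refine le_of_mul_le_mul_right (h5.trans ?_) hU
    rw [mul_assoc]
    refine mul_le_mul_of_nonneg_left (h1.trans ?_) (Nat.cast_nonneg _)
    gcongr
  rw [div_le_iff₀ (by positivity)]
  refine le_trans (mul_le_of_le_one_right (by positivity) ?_) h6
  have : 0 < 1 / (q : ℝ) := by positivity
  linarith
end

section
/- Let F be a finite field with exactly q elements and n ≥ 1. Then for every g in the symplectic group Sp(2n,F), the order of the centralizer of g in Sp(2n,F) is at least q^n · [ (1 − 1/q) / (2e · (log(4n)/log(q) + 4)) ]^{1/2}, where e is Euler's number and log is the natural logarithm. -/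
open scoped Matrix

/-- The matrix of the standard symplectic form: `[[0, Iₙ], [-Iₙ, 0]]`. -/
def sympJ (n : ℕ) (F : Type*) [Field F] :
    Matrix (Fin n ⊕ Fin n) (Fin n ⊕ Fin n) F :=
  Matrix.fromBlocks 0 1 (-1) 0

/-- The symplectic group `Sp(2n, F)`: invertible `2n × 2n` matrices `A` with
`Aᵀ * J * A = J`, where `J = [[0, Iₙ], [-Iₙ, 0]]`. -/
def Sp (n : ℕ) (F : Type*) [Field F] :
    Subgroup (Matrix.GeneralLinearGroup (Fin n ⊕ Fin n) F) where
  carrier := {A | (A : Matrix (Fin n ⊕ Fin n) (Fin n ⊕ Fin n) F)ᵀ * sympJ n F *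
      (A : Matrix (Fin n ⊕ Fin n) (Fin n ⊕ Fin n) F) = sympJ n F}
  one_mem' := by simp
  mul_mem' := by
    intro A B hA hB
    simp only [Set.mem_setOf_eq] at hA hB ⊢
    rw [Units.val_mul, Matrix.transpose_mul]
    calc (B : Matrix _ _ F)ᵀ * (A : Matrix _ _ F)ᵀ * sympJ n F *
          ((A : Matrix _ _ F) * (B : Matrix _ _ F))
        = (B : Matrix _ _ F)ᵀ * ((A : Matrix _ _ F)ᵀ * sympJ n F * (A : Matrix _ _ F)) *
            (B : Matrix _ _ F) := by simp only [mul_assoc]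
      _ = sympJ n F := by rw [hA, hB]
  inv_mem' := by
    intro A hA
    simp only [Set.mem_setOf_eq] at hA ⊢
    have h1 : (A : Matrix (Fin n ⊕ Fin n) (Fin n ⊕ Fin n) F) *
        (↑A⁻¹ : Matrix (Fin n ⊕ Fin n) (Fin n ⊕ Fin n) F) = 1 := A.mul_inv
    conv_lhs => rw [← hA]
    calc (↑A⁻¹ : Matrix _ _ F)ᵀ * ((A : Matrix _ _ F)ᵀ * sympJ n F * (A : Matrix _ _ F)) *
          (↑A⁻¹ : Matrix _ _ F)
        = ((A : Matrix _ _ F) * (↑A⁻¹ : Matrix _ _ F))ᵀ * sympJ n F *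
            ((A : Matrix _ _ F) * (↑A⁻¹ : Matrix _ _ F)) := by
          rw [Matrix.transpose_mul]; simp only [mul_assoc]
      _ = sympJ n F := by rw [h1]; simp

/-- A nondegenerate alternating bilinear form on an `A`-module for which the action of `a` is
adjoint to the action of `σ a`. -/
structure IsSymplecticForm {F A V : Type*} [Field F] [CommRing A] [Algebra F A]
    [AddCommGroup V] [Module F V] [Module A V] (σ : A →ₐ[F] A)
    (B : LinearMap.BilinForm F V) : Prop where
  alt : ∀ x, B x x = 0
  nondeg : ∀ x, (∀ y, B x y = 0) → x = 0
  adj : ∀ (a : A) (x y : V), B (a • x) y = B x (σ a • y)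

namespace IsSymplecticForm

variable {F A V : Type*} [Field F] [CommRing A] [Algebra F A]
  [AddCommGroup V] [Module F V] [Module A V] {σ : A →ₐ[F] A} {B : LinearMap.BilinForm F V}

theorem neg_swap (hB : IsSymplecticForm σ B) (x y : V) : B x y = -B y x := by
  have h := hB.alt (x + y)
  simp only [map_add, LinearMap.add_apply, hB.alt, zero_add, add_zero] at h
  exact eq_neg_of_add_eq_zero_right h

theorem nondeg_right (hB : IsSymplecticForm σ B) (y : V) (h : ∀ x, B x y = 0) : y = 0 :=
  hB.nondeg y fun x => by rw [hB.neg_swap, h, neg_zero]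

theorem nondegenerate (hB : IsSymplecticForm σ B) : B.Nondegenerate :=
  ⟨fun x h => hB.nondeg x h, fun y h => hB.nondeg_right y h⟩

/-- Every functional is represented by the form. -/
theorem exists_repr [Finite V] [Finite F] (hB : IsSymplecticForm σ B) (φ : V →ₗ[F] F) :
    ∃ y, ∀ x, B x y = φ x := by
  have hinj : Function.Injective B.flip := by
    rw [injective_iff_map_eq_zero]
    intro y hy
    exact hB.nondeg_right y fun x => by simpa using LinearMap.congr_fun hy x
  have hfin : Module.finrank F V = Module.finrank F (V →ₗ[F] F) :=
    (Subspace.dual_finrank_eq (K := F) (V := V)).symm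
  obtain ⟨y, hy⟩ := (LinearMap.injective_iff_surjective_of_finrank_eq_finrank hfin).1 hinj φ
  exact ⟨y, fun x => by rw [← hy]; rfl⟩

theorem card_sq_le_of_isotropic [Finite V] [Finite F] (hB : IsSymplecticForm σ B)
    {S : Submodule F V} (hS : ∀ s ∈ S, ∀ t ∈ S, B s t = 0) : Nat.card S ^ 2 ≤ Nat.card V := by
  have h1 : S ≤ B.orthogonal S := fun t ht s hs => hS s hs t ht
  have h2 := LinearMap.BilinForm.finrank_orthogonal hB.nondegenerate S
  have h3 := Submodule.finrank_mono h1
  have h4 := Submodule.finrank_le S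
  rw [Module.natCard_eq_pow_finrank (K := F) (V := S),
    Module.natCard_eq_pow_finrank (K := F) (V := V), ← pow_mul]
  exact Nat.pow_le_pow_right Nat.card_pos (by lia)

/-- Every `A`-linear endomorphism has an `A`-linear adjoint. -/
theorem exists_adjoint [IsScalarTower F A V] [Finite V] [Finite F] (hB : IsSymplecticForm σ B)
    (hσ : ∀ a, σ (σ a) = a) (T : V →ₗ[A] V) :
    ∃ T' : V →ₗ[A] V, ∀ x y, B (T x) y = B x (T' y) := by
  choose T' hT' using fun y => hB.exists_repr ((B.flip y).comp (T.restrictScalars F))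
  have hT : ∀ x y, B x (T' y) = B (T x) y := fun x y => hT' y x
  have huniq : ∀ y z, (∀ x, B x z = B (T x) y) → T' y = z := by
    intro y z h
    refine sub_eq_zero.1 (hB.nondeg_right _ fun x => ?_)
    rw [map_sub, hT, h, sub_self]
  refine ⟨⟨⟨T', fun y z => huniq _ _ fun x => ?_⟩, fun a y => huniq _ _ fun x => ?_⟩,
    fun x y => (hT x y).symm⟩
  · rw [map_add, map_add, hT, hT]
  · have h := hB.adj (σ a) x (T' y)
    have h' := hB.adj (σ a) (T x) y
    rw [hσ] at h h'
    rw [RingHom.id_apply, ← h', ← map_smul T, ← hT]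
    exact h.symm

end IsSymplecticForm

/-- The number of `A`-linear automorphisms preserving a bilinear form. -/
noncomputable def isometryCard {F V : Type*} (A : Type*) [Field F] [CommRing A]
    [AddCommGroup V] [Module F V] [Module A V] (B : LinearMap.BilinForm F V) : ℕ :=
  Nat.card {h : V ≃ₗ[A] V // ∀ x y, B (h x) (h y) = B x y}

/-- The pullback of a bilinear form along an `A`-linear map. -/
def pullbackForm {F A U V : Type*} [Field F] [CommRing A] [Algebra F A]
    [AddCommGroup V] [Module F V] [Module A V] [IsScalarTower F A V]
    [AddCommGroup U] [Module F U] [Module A U] [IsScalarTower F A U]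
    (B : LinearMap.BilinForm F V) (i : U →ₗ[A] V) : LinearMap.BilinForm F U :=
  B.compl₁₂ (i.restrictScalars F) (i.restrictScalars F)

section

variable {F A V U W : Type*} [Field F] [CommRing A] [Algebra F A]
  [AddCommGroup V] [Module F V] [Module A V] [IsScalarTower F A V]
  [AddCommGroup U] [Module F U] [Module A U] [IsScalarTower F A U]
  [AddCommGroup W] [Module F W] [Module A W] [IsScalarTower F A W]
  {σ : A →ₐ[F] A} {B : LinearMap.BilinForm F V}

@[simp] theorem pullbackForm_apply (i : U →ₗ[A] V) (x y : U) :
    pullbackForm B i x y = B (i x) (i y) := rfl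

instance finite_linearEquiv [Finite V] : Finite (V ≃ₗ[A] V) :=
  Finite.of_injective (fun h : V ≃ₗ[A] V => (h : V → V)) DFunLike.coe_injective

omit [Algebra F A] [IsScalarTower F A V] in
theorem isometryCard_pos [Finite V] : 0 < isometryCard A B := by
  have : Nonempty {h : V ≃ₗ[A] V // ∀ x y, B (h x) (h y) = B x y} :=
    ⟨⟨LinearEquiv.refl A V, fun _ _ => rfl⟩⟩
  exact Nat.card_pos

theorem isometryCard_mul_le [Finite V] [Finite U] [Finite W] (i : U →ₗ[A] V) (j : W →ₗ[A] V)
    (e : (U × W) ≃ₗ[A] V) (he : ∀ u w, e (u, w) = i u + j w)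
    (hij : ∀ u w, B (i u) (j w) = 0) (hji : ∀ u w, B (j w) (i u) = 0) :
    isometryCard A (pullbackForm B i) * isometryCard A (pullbackForm B j) ≤
      isometryCard A B := by
  rw [isometryCard, isometryCard, isometryCard, ← Nat.card_prod]
  refine Nat.card_le_card_of_injective
    (fun p => ⟨(e.symm.trans (LinearEquiv.prodCongr p.1.1 p.2.1)).trans e, fun x y => ?_⟩) ?_
  · obtain ⟨⟨u, w⟩, rfl⟩ := e.surjective x
    obtain ⟨⟨u', w'⟩, rfl⟩ := e.surjective y
    have h1 := p.1.2 u u'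
    have h2 := p.2.2 w w'
    simp only [pullbackForm_apply] at h1 h2
    simp only [LinearEquiv.trans_apply, LinearEquiv.symm_apply_apply]
    simp only [LinearEquiv.prodCongr_apply, he, map_add, LinearMap.add_apply, hij, hji, h1, h2]
  · rintro ⟨⟨f, hf⟩, ⟨k, hk⟩⟩ ⟨⟨f', hf'⟩, ⟨k', hk'⟩⟩ h
    have h' : ∀ u w, (f u, k w) = (f' u, k' w) := by
      intro u w
      have := LinearEquiv.congr_fun (Subtype.ext_iff.1 h) (e (u, w))
      simpa using this
    have hff : f = f' := LinearEquiv.ext fun u => congrArg Prod.fst (h' u 0)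
    have hkk : k = k' := LinearEquiv.ext fun w => congrArg Prod.snd (h' 0 w)
    subst hff hkk
    rfl

/-- A nondegenerate piece splits off orthogonally. -/
theorem exists_orthogonal_complement [Finite F] [Finite V] [Finite U] (hB : IsSymplecticForm σ B)
    (hσ : ∀ a, σ (σ a) = a) (i : U →ₗ[A] V) (hi : IsSymplecticForm σ (pullbackForm B i)) :
    ∃ X : Submodule A V, IsSymplecticForm σ (pullbackForm B X.subtype) ∧
      Nat.card V = Nat.card U * Nat.card X ∧
      isometryCard A (pullbackForm B i) * isometryCard A (pullbackForm B X.subtype) ≤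
        isometryCard A B := by
  let X : Submodule A V :=
    { carrier := {y | ∀ u, B (i u) y = 0}
      add_mem' := fun {a b} ha hb u => by
        rw [map_add, ha u, hb u, add_zero]
      zero_mem' := fun u => map_zero _
      smul_mem' := fun a y hy u => by
        have h := hB.adj (σ a) (i u) y
        rw [hσ, ← map_smul] at h
        rw [← h]
        exact hy _ }
  have hX : ∀ (u : U) (w : X), B (i u) w = 0 := fun u w => w.2 u
  have hX' : ∀ (u : U) (w : X), B w (i u) = 0 := fun u w => by rw [hB.neg_swap, hX, neg_zero]
  let f : (U × X) →ₗ[A] V := i.coprod X.subtype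
  have hf : ∀ u w, f (u, w) = i u + w := fun u w => by simp [f]
  have hfi : Function.Injective f := by
    rw [injective_iff_map_eq_zero]
    rintro ⟨u, w⟩ h
    rw [hf] at h
    have hu : u = 0 := hi.nondeg_right u fun x => by
      rw [pullbackForm_apply, eq_neg_of_add_eq_zero_left h, map_neg, hX, neg_zero]
    subst hu
    rw [map_zero, zero_add] at h
    ext
    · rfl
    · exact h
  have hfs : Function.Surjective f := by
    intro y
    obtain ⟨u, hu⟩ := hi.exists_repr ((B.flip y).comp (i.restrictScalars F))
    refine ⟨(u, ⟨y - i u, fun x => ?_⟩), ?_⟩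
    · have := hu x
      rw [map_sub, sub_eq_zero]
      exact this.symm
    · rw [hf]; simp
  let e := LinearEquiv.ofBijective f ⟨hfi, hfs⟩
  refine ⟨X, ⟨fun x => hB.alt _, fun x h => ?_, fun a x y => ?_⟩, ?_, ?_⟩
  · refine Subtype.ext (hB.nondeg _ fun y => ?_)
    obtain ⟨⟨u, w⟩, rfl⟩ := hfs y
    rw [hf, map_add, hX', zero_add]
    exact h w
  · exact hB.adj a x y
  · rw [← Nat.card_prod]
    exact (Nat.card_congr e.toEquiv).symm
  · exact isometryCard_mul_le i X.subtype e (fun u w => hf u w) hX hX'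

end

section

/-- Counting automorphisms by the forms they pull `B` back to. -/
theorem card_le_isometryCard_mul {F A V G T : Type*} [Field F] [CommRing A] [AddCommGroup V]
    [Module F V] [Module A V] [Finite V] [Finite T] {B : LinearMap.BilinForm F V}
    (Φ : G → (V ≃ₗ[A] V)) (hΦ : Function.Injective Φ) (f : G → T)
    (hf : ∀ g g', f g = f g' → ∀ x y, B (Φ g x) (Φ g y) = B (Φ g' x) (Φ g' y)) :
    Nat.card G ≤ isometryCard A B * Nat.card T := by
  rcases isEmpty_or_nonempty G with hG | hG
  · simp
  have hs : ∀ g, f (Function.invFun f (f g)) = f g := fun g => Function.invFun_eq ⟨g, rfl⟩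
  rw [isometryCard, ← Nat.card_prod]
  refine Nat.card_le_card_of_injective
    (fun g => (⟨(Φ (Function.invFun f (f g))).symm.trans (Φ g), fun x y => ?_⟩, f g)) ?_
  · rw [LinearEquiv.trans_apply, LinearEquiv.trans_apply, ← hf _ _ (hs g)]
    simp
  · intro g g' h
    simp only [Prod.mk.injEq, Subtype.mk.injEq] at h
    obtain ⟨h1, h2⟩ := h
    rw [h2] at h1
    refine hΦ (LinearEquiv.ext fun x => ?_)
    simpa using LinearEquiv.congr_fun h1 (Φ (Function.invFun f (f g')) x)

variable {R : Type*} [CommRing R] [IsLocalRing R] [Finite R]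

omit [IsLocalRing R] [Finite R] in
theorem ncard_isUnit_eq : {x : R | IsUnit x}.ncard = Nat.card Rˣ := by
  have h : {x : R | IsUnit x} = Set.range (Units.val : Rˣ → R) := by
    ext x
    simp [IsUnit]
  rw [h, ← Nat.card_coe_set_eq]
  exact Nat.card_range_of_injective Units.val_injective

theorem card_le_two_mul_card_units : Nat.card R ≤ 2 * Nat.card Rˣ := by
  have h1 := Set.ncard_add_ncard_compl {x : R | IsUnit x}
  have h2 : {x : R | IsUnit x}ᶜ.ncard ≤ {x : R | IsUnit x}.ncard := by
    refine Set.ncard_le_ncard_of_injOn (fun x => 1 - x) (fun x hx => ?_) (fun x _ y _ h => ?_)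
    · rcases IsLocalRing.isUnit_or_isUnit_one_sub_self x with h | h
      · exact absurd h hx
      · exact h
    · simpa using h
  rw [ncard_isUnit_eq] at h1 h2
  lia

variable {F : Type*} [Field F] [Finite F] [Algebra F R]

/-- In a finite local ring the proportion of units in a subspace is at most that in the ring. -/
theorem card_units_submodule_le (S : Submodule F R) :
    {x : R | x ∈ S ∧ IsUnit x}.ncard * Nat.card R ≤ Nat.card S * Nat.card Rˣ := by
  let M : Submodule F R := (IsLocalRing.maximalIdeal R).restrictScalars F
  have hM : ∀ x, x ∈ M ↔ ¬ IsUnit x := fun x => IsLocalRing.mem_maximalIdeal x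
  have h1 : Nat.card M + Nat.card Rˣ = Nat.card R := by
    rw [← ncard_isUnit_eq, ← Set.ncard_add_ncard_compl {x : R | IsUnit x}, add_comm]
    congr 1
  have h2 : Nat.card (S ⊓ M : Submodule F R) + {x : R | x ∈ S ∧ IsUnit x}.ncard = Nat.card S := by
    have e1 : Nat.card (S ⊓ M : Submodule F R) = ((S : Set R) ∩ M).ncard :=
      Nat.card_coe_set_eq _
    have e2 : {x : R | x ∈ S ∧ IsUnit x} = (S : Set R) \ M := by
      ext x
      exact ⟨fun h => ⟨h.1, fun h' => (hM x).1 h' h.2⟩,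
        fun h => ⟨h.1, by_contra fun h' => h.2 ((hM x).2 h')⟩⟩
    rw [e1, e2, Set.ncard_inter_add_ncard_sdiff_eq_ncard _ _ (Set.toFinite _)]
    exact (Nat.card_coe_set_eq _).symm
  have h3 : Nat.card S * Nat.card M ≤ Nat.card R * Nat.card (S ⊓ M : Submodule F R) := by
    have hfin := Submodule.finrank_sup_add_finrank_inf_eq S M
    have hle := Submodule.finrank_le (S ⊔ M)
    rw [Module.natCard_eq_pow_finrank (K := F) (V := S),
      Module.natCard_eq_pow_finrank (K := F) (V := M),
      Module.natCard_eq_pow_finrank (K := F) (V := R),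
      Module.natCard_eq_pow_finrank (K := F) (V := (S ⊓ M : Submodule F R)), ← pow_add, ← pow_add]
    exact Nat.pow_le_pow_right Nat.card_pos (by lia)
  nlinarith

/-- The centralizer bound for a nondegenerate cyclic module over a local ring. -/
theorem card_le_isometryCard_sq_of_cyclic {σ : R →ₐ[F] R} (hσ : ∀ a, σ (σ a) = a)
    {B : LinearMap.BilinForm F R} (hB : IsSymplecticForm σ B) :
    Nat.card R ≤ isometryCard R B ^ 2 := by
  let S : Submodule F R := Submodule.span F (Set.range fun a : R => a * σ a)
  have hS1 : ∀ s ∈ S, B s 1 = 0 := by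
    intro s hs
    induction hs using Submodule.span_induction with
    | mem x hx =>
      obtain ⟨a, rfl⟩ := hx
      have h := hB.adj a (σ a) 1
      simp only [smul_eq_mul, mul_one] at h
      rw [h, hB.alt]
    | zero => simp
    | add x y _ _ hx hy => rw [map_add, LinearMap.add_apply, hx, hy, add_zero]
    | smul c x _ hx => rw [map_smul, LinearMap.smul_apply, hx, smul_zero]
  have hSσ : ∀ s ∈ S, σ s = s := by
    intro s hs
    induction hs using Submodule.span_induction with
    | mem x hx =>
      obtain ⟨a, rfl⟩ := hx
      simp only [map_mul, hσ, mul_comm]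
    | zero => simp
    | add x y _ _ hx hy => rw [map_add, hx, hy]
    | smul c x _ hx => rw [map_smul, hx]
  have hSmul : ∀ s ∈ S, ∀ t ∈ S, s * t ∈ S := by
    intro s hs t ht
    induction hs using Submodule.span_induction with
    | mem x hx =>
      obtain ⟨a, rfl⟩ := hx
      induction ht using Submodule.span_induction with
      | mem y hy =>
        obtain ⟨b, rfl⟩ := hy
        refine Submodule.subset_span ⟨a * b, ?_⟩
        simp only [map_mul]
        ring
      | zero => simp
      | add x y _ _ hx hy => rw [mul_add]; exact add_mem hx hy
      | smul c x _ hx => rw [mul_smul_comm]; exact Submodule.smul_mem _ _ hx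
    | zero => simp
    | add x y _ _ hx hy => rw [add_mul]; exact add_mem hx hy
    | smul c x _ hx => rw [smul_mul_assoc]; exact Submodule.smul_mem _ _ hx
  have hSS : ∀ s ∈ S, ∀ t ∈ S, B s t = 0 := by
    intro s hs t ht
    have h := hB.adj t s 1
    rw [hSσ t ht, smul_eq_mul, smul_eq_mul, mul_one] at h
    rw [← h]
    exact hS1 _ (hSmul t ht s hs)
  have hScard : Nat.card S ^ 2 ≤ Nat.card R := hB.card_sq_le_of_isotropic hSS
  have hinj : Function.Injective fun u : Rˣ => (LinearEquiv.smulOfUnit u : R ≃ₗ[R] R) := by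
    intro u v h
    refine Units.ext ?_
    have h1 : (u : R) * 1 = v * 1 := LinearEquiv.congr_fun h 1
    simpa using h1
  have hcount := card_le_isometryCard_mul (A := R) (B := B) (G := Rˣ)
    (T := {x : R | x ∈ S ∧ IsUnit x})
    (fun u => LinearEquiv.smulOfUnit u)
    hinj
    (fun u => ⟨u * σ u, Submodule.subset_span ⟨u, rfl⟩, u.isUnit.mul (u.isUnit.map σ)⟩)
    (fun u v h x y => by
      have h' : (u : R) * σ u = v * σ v := congrArg Subtype.val h
      have key : ∀ w : Rˣ, B ((LinearEquiv.smulOfUnit w : R ≃ₗ[R] R) x)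
          ((LinearEquiv.smulOfUnit w : R ≃ₗ[R] R) y) = B x ((w * σ w) * y) := by
        intro w
        have := hB.adj w x ((w : R) * y)
        simp only [smul_eq_mul] at this
        rw [mul_comm (w : R) (σ w), mul_assoc, ← this]
        rfl
      rw [key, key, h'])
  rw [Nat.card_coe_set_eq] at hcount
  have hunits := card_units_submodule_le S
  have hpos : 0 < Nat.card Rˣ := Nat.card_pos
  have h1 : Nat.card R ≤ isometryCard R B * Nat.card S := by
    refine Nat.le_of_mul_le_mul_left ?_ hpos
    calc Nat.card Rˣ * Nat.card R
        ≤ isometryCard R B * {x : R | x ∈ S ∧ IsUnit x}.ncard * Nat.card R :=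
          Nat.mul_le_mul_right _ hcount
      _ = isometryCard R B * ({x : R | x ∈ S ∧ IsUnit x}.ncard * Nat.card R) := by ring
      _ ≤ isometryCard R B * (Nat.card S * Nat.card Rˣ) := Nat.mul_le_mul_left _ hunits
      _ = Nat.card Rˣ * (isometryCard R B * Nat.card S) := by ring
  refine Nat.le_of_mul_le_mul_left ?_ (Nat.card_pos (α := R))
  calc Nat.card R * Nat.card R ≤ (isometryCard R B * Nat.card S) ^ 2 := by
        rw [← sq]; exact Nat.pow_le_pow_left h1 2
    _ = isometryCard R B ^ 2 * Nat.card S ^ 2 := by ring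
    _ ≤ isometryCard R B ^ 2 * Nat.card R := Nat.mul_le_mul_left _ hScard
    _ = Nat.card R * isometryCard R B ^ 2 := by ring

/-- The automorphism of `R × R` with matrix rows `(a, b)` and `(c a, c b + d)`. -/
noncomputable def pairAut (t : Rˣ × R × R × Rˣ) : (R × R) ≃ₗ[R] (R × R) :=
  LinearEquiv.ofBijective
    ((LinearMap.toSpanSingleton R (R × R) ((t.1 : R), t.2.1)).coprod
      (LinearMap.toSpanSingleton R (R × R)
        (t.2.2.1 * t.1, t.2.2.1 * t.2.1 + t.2.2.2))) <| by
    refine Finite.injective_iff_bijective.1 ((injective_iff_map_eq_zero _).2 ?_)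
    obtain ⟨a, b, c, d⟩ := t
    rintro ⟨x, y⟩ h
    simp only [LinearMap.coprod_apply, LinearMap.toSpanSingleton_apply, Prod.smul_mk,
      smul_eq_mul, Prod.mk_add_mk, Prod.mk_eq_zero] at h
    obtain ⟨h1, h2⟩ := h
    have h3 : x + y * c = 0 := by
      have : (x + y * c) * (a : R) = 0 := by linear_combination h1
      exact (a.mul_left_eq_zero).1 this
    have hy : y = 0 := by
      have : y * (d : R) = 0 := by linear_combination h2 - b * h3
      exact (d.mul_left_eq_zero).1 this
    subst hy
    simpa using h3

omit [IsLocalRing R] in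
theorem pairAut_fst (t : Rˣ × R × R × Rˣ) : pairAut t (1, 0) = ((t.1 : R), t.2.1) := by
  simp [pairAut]

omit [IsLocalRing R] in
theorem pairAut_snd (t : Rˣ × R × R × Rˣ) :
    pairAut t (0, 1) = (t.2.2.1 * t.1, t.2.2.1 * t.2.1 + t.2.2.2) := by
  simp [pairAut]

omit [IsLocalRing R] in
theorem pairAut_injective : Function.Injective (pairAut (R := R)) := by
  intro t t' h
  have h1 := pairAut_fst t
  have h2 := pairAut_snd t
  rw [h, pairAut_fst] at h1
  rw [h, pairAut_snd] at h2
  obtain ⟨a, b, c, d⟩ := t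
  obtain ⟨a', b', c', d'⟩ := t'
  simp only [Prod.mk.injEq, Units.val_inj] at h1 h2
  obtain ⟨rfl, rfl⟩ := h1
  obtain ⟨h2, h3⟩ := h2
  have hc : c' = c := (Units.mul_left_inj a').1 h2
  subst hc
  simpa [Units.val_inj, eq_comm] using h3

/-- The centralizer bound for a free module of rank two over a local ring. -/
theorem card_le_isometryCard_of_rank_two {σ : R →ₐ[F] R} (hσ : ∀ a, σ (σ a) = a)
    {B : LinearMap.BilinForm F (R × R)} (hB : IsSymplecticForm σ B) :
    Nat.card R ≤ isometryCard R B := by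
  let D : Submodule F (R →ₗ[F] F) :=
    LinearMap.ker ((LinearMap.applyₗ (1 : R)) : (R →ₗ[F] F) →ₗ[F] F)
  have hfinD : Module.finrank F (R →ₗ[F] F) = Module.finrank F R :=
    Subspace.dual_finrank_eq (K := F) (V := R)
  have : Finite (R →ₗ[F] F) := Finite.of_injective _ (DFunLike.coe_injective (F := R →ₗ[F] F))
  have hdual : Nat.card (R →ₗ[F] F) = Nat.card R := by
    rw [Module.natCard_eq_pow_finrank (K := F) (V := R →ₗ[F] F), hfinD,
      ← Module.natCard_eq_pow_finrank (K := F) (V := R)]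
  have hD : 2 * Nat.card D ≤ Nat.card R := by
    have hlt : Module.finrank F D < Module.finrank F R := by
      rw [← hfinD]
      refine Submodule.finrank_lt (fun htop => ?_)
      refine one_ne_zero ((Module.forall_dual_apply_eq_zero_iff F (1 : R)).1 fun φ => ?_)
      have h : φ ∈ D := by rw [htop]; trivial
      exact h
    have hF : 2 ≤ Nat.card F := Finite.one_lt_card
    calc 2 * Nat.card D ≤ Nat.card F * Nat.card F ^ Module.finrank F D := by
          rw [Module.natCard_eq_pow_finrank (K := F) (V := D)]
          exact Nat.mul_le_mul_right _ hF
      _ = Nat.card F ^ (Module.finrank F D + 1) := by rw [pow_succ']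
      _ ≤ Nat.card F ^ Module.finrank F R := Nat.pow_le_pow_right Nat.card_pos hlt
      _ = Nat.card R := (Module.natCard_eq_pow_finrank (K := F) (V := R)).symm
  let φ : (Rˣ × R × R × Rˣ) → R × R → R × R → (R →ₗ[F] F) := fun t x y =>
    (B.flip (pairAut t y)).comp
      ((LinearMap.toSpanSingleton R (R × R) (pairAut t x)).restrictScalars F)
  have hφ : ∀ t x y r, φ t x y r = B (r • pairAut t x) (pairAut t y) := fun _ _ _ _ => rfl
  have hφD : ∀ t x, φ t x x ∈ D := fun t x => by
    change φ t x x 1 = 0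
    rw [hφ, one_smul, hB.alt]
  have hcount := card_le_isometryCard_mul (A := R) (B := B) (T := (R →ₗ[F] F) × D × D)
    pairAut pairAut_injective
    (fun t => (φ t (1, 0) (0, 1), ⟨φ t (1, 0) (1, 0), hφD _ _⟩, ⟨φ t (0, 1) (0, 1), hφD _ _⟩))
    (fun t t' h x y => by
      simp only [Prod.mk.injEq, Subtype.mk.injEq] at h
      obtain ⟨h1, h2, h3⟩ := h
      have key : ∀ s, B (pairAut s x) (pairAut s y) =
          φ s (1, 0) (1, 0) (σ y.1 * x.1) + φ s (1, 0) (0, 1) (σ y.2 * x.1)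
            - φ s (1, 0) (0, 1) (σ x.2 * y.1) + φ s (0, 1) (0, 1) (σ y.2 * x.2) := by
        intro s
        have hx : ∀ z : R × R, pairAut s z = z.1 • pairAut s (1, 0) + z.2 • pairAut s (0, 1) := by
          intro z
          rw [← map_smul, ← map_smul, ← map_add]
          simp
        have hadj : ∀ (a b : R) (v w : R × R), B (a • v) (b • w) = B ((σ b * a) • v) w := by
          intro a b v w
          rw [mul_smul, hB.adj (σ b), hσ]
        rw [hx x, hx y]
        simp only [map_add, LinearMap.add_apply, hφ]
        rw [hB.neg_swap (x.2 • pairAut s (0, 1)) (y.1 • pairAut s (1, 0)), hadj x.1 y.1,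
          hadj x.1 y.2, hadj y.1 x.2, hadj x.2 y.2]
        ring
      rw [key, key, h1, h2, h3])
  have hu := card_le_two_mul_card_units (R := R)
  simp only [Nat.card_prod, hdual] at hcount
  have hpos : 0 < Nat.card R := Nat.card_pos
  generalize Nat.card R = r at *
  generalize Nat.card Rˣ = u at *
  generalize Nat.card D = d at *
  generalize isometryCard R B = c at *
  refine Nat.le_of_mul_le_mul_left ?_ (by positivity : 0 < r * (r * r))
  calc r * (r * r) * r = (r * r) * (r * r) := by ring
    _ ≤ (2 * u * (2 * u)) * (r * r) := Nat.mul_le_mul_right _ (Nat.mul_le_mul hu hu)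
    _ = 4 * (u * (r * (r * u))) := by ring
    _ ≤ 4 * (c * (r * (d * d))) := Nat.mul_le_mul_left _ hcount
    _ = c * r * (2 * d * (2 * d)) := by ring
    _ ≤ c * r * (r * r) := Nat.mul_le_mul_left _ (Nat.mul_le_mul hD hD)
    _ = r * (r * r) * c := by ring

end

section

variable {A : Type*} [CommRing A]

theorem exists_mul_eq_one_add {p a : A} (hp : (Ideal.span {p}).IsMaximal) (ha : ¬ p ∣ a) (k : ℕ) :
    ∃ c e, c * a = 1 + e * p ^ k := by
  have h : IsCoprime a p := by
    rw [← Ideal.isCoprime_span_singleton_iff, Ideal.isCoprime_iff_sup_eq, sup_comm]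
    refine hp.1.2 _ (lt_of_le_of_ne le_sup_left fun heq => ha ?_)
    rw [← Ideal.mem_span_singleton, heq]
    exact Ideal.mem_sup_right (Ideal.mem_span_singleton_self a)
  obtain ⟨c, e, hce⟩ := h.pow_right (n := k)
  exact ⟨c, -e, by linear_combination hce⟩

theorem exists_ne_zero_smul_eq_zero {V : Type*} [AddCommGroup V] [Module A V] {p : A} {k : ℕ}
    {x : V} (hx : x ≠ 0) (hk : p ^ k • x = 0) : ∃ a : A, a • x ≠ 0 ∧ p • a • x = 0 := by
  classical
  have h : ∃ k : ℕ, p ^ k • x = 0 := ⟨k, hk⟩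
  have h0 : Nat.find h ≠ 0 := by
    rw [Ne, Nat.find_eq_zero]
    simpa using hx
  obtain ⟨t, ht⟩ := Nat.exists_eq_succ_of_ne_zero h0
  refine ⟨p ^ t, Nat.find_min h (by lia), ?_⟩
  have := Nat.find_spec h
  rwa [ht, Nat.succ_eq_add_one, pow_succ', mul_smul] at this

theorem exists_exponent {V : Type*} [AddCommGroup V] [Module A V] [Nontrivial V] {p : A} {N : ℕ}
    (hN : ∀ x : V, p ^ N • x = 0) :
    ∃ k, (∀ x : V, p ^ (k + 1) • x = 0) ∧ ∃ x : V, p ^ k • x ≠ 0 := by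
  classical
  have h : ∃ N, ∀ x : V, p ^ N • x = 0 := ⟨N, hN⟩
  have h0 : Nat.find h ≠ 0 := by
    intro h0
    obtain ⟨x, hx⟩ := exists_ne (0 : V)
    have := Nat.find_spec h x
    rw [h0, pow_zero, one_smul] at this
    exact hx this
  obtain ⟨t, ht⟩ := Nat.exists_eq_succ_of_ne_zero h0
  refine ⟨t, fun x => ?_, ?_⟩
  · have := Nat.find_spec h x
    rwa [ht] at this
  · have := Nat.find_min h (m := t) (by lia)
    push Not at this
    exact this

theorem isLocalRing_quotient_pow {p : A} (hp : (Ideal.span {p}).IsMaximal) {k : ℕ} (hk : k ≠ 0) :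
    IsLocalRing (A ⧸ Ideal.span {p ^ k}) := by
  have hu : ∀ a : A, ¬ p ∣ a → IsUnit (Ideal.Quotient.mk (Ideal.span {p ^ k}) a) := by
    intro a ha
    obtain ⟨c, e, h⟩ := exists_mul_eq_one_add hp ha k
    refine IsUnit.of_mul_eq_one_right (Ideal.Quotient.mk _ c) ?_
    rw [← map_mul, h, ← map_one (Ideal.Quotient.mk (Ideal.span {p ^ k})), Ideal.Quotient.eq,
      Ideal.mem_span_singleton]
    exact ⟨e, by ring⟩
  have hp1 : ¬ p ∣ 1 := fun h => hp.ne_top ((Ideal.eq_top_iff_one _).2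
    (Ideal.mem_span_singleton.2 h))
  have : Nontrivial (A ⧸ Ideal.span {p ^ k}) := by
    refine Ideal.Quotient.nontrivial_iff.2 fun h => hp1 ?_
    rw [Ideal.eq_top_iff_one, Ideal.mem_span_singleton] at h
    exact (dvd_pow_self p hk).trans h
  refine IsLocalRing.of_isUnit_or_isUnit_one_sub_self fun r => ?_
  obtain ⟨a, rfl⟩ := Ideal.Quotient.mk_surjective r
  by_cases ha : p ∣ a
  · right
    rw [← map_one (Ideal.Quotient.mk (Ideal.span {p ^ k})), ← map_sub]
    exact hu _ fun h => hp1 ((dvd_sub_left ha).1 h)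
  · exact Or.inl (hu a ha)

theorem mk_eq_of_smul_eq_zero [IsDomain A] {p : A} (hp : p ≠ 0) {k : ℕ}
    {r : A ⧸ Ideal.span {p ^ (k + 1)}} (h : p • r = 0) :
    ∃ a, r = Ideal.Quotient.mk _ (p ^ k * a) ∧ (r ≠ 0 → ¬ p ∣ a) := by
  obtain ⟨b, rfl⟩ := Ideal.Quotient.mk_surjective r
  have h' : Ideal.Quotient.mk (Ideal.span {p ^ (k + 1)}) (p * b) = 0 := h
  rw [Ideal.Quotient.eq_zero_iff_mem, Ideal.mem_span_singleton, pow_succ'] at h'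
  obtain ⟨c, hc⟩ := h'
  have hb : b = p ^ k * c := mul_left_cancel₀ hp (by linear_combination hc)
  refine ⟨c, by rw [hb], fun hne ⟨d, hd⟩ => hne ?_⟩
  rw [Ideal.Quotient.eq_zero_iff_mem, Ideal.mem_span_singleton, hb, hd]
  exact ⟨d, by ring⟩

/-- The map from a quotient ring sending `1` to `m`. -/
noncomputable def quotientMap {V : Type*} [AddCommGroup V] [Module A V] {p : A} {m : V}
    (hm : p • m = 0) : (A ⧸ Ideal.span {p}) →ₗ[A] V :=
  Submodule.liftQ _ (LinearMap.toSpanSingleton A V m) <| by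
    rw [Ideal.span, Submodule.span_le, Set.singleton_subset_iff]
    exact hm

@[simp] theorem quotientMap_mk {V : Type*} [AddCommGroup V] [Module A V] {p : A} {m : V}
    (hm : p • m = 0) (a : A) : quotientMap hm (Ideal.Quotient.mk _ a) = a • m := rfl

/-- Every nonzero submodule of `A ⧸ (p ^ (k + 1))` contains `p ^ k`. -/
theorem mk_pow_mem_of_ne_bot [IsDomain A] {p : A} (hp : (Ideal.span {p}).IsMaximal) (hp0 : p ≠ 0)
    {k : ℕ} {X : Submodule A (A ⧸ Ideal.span {p ^ (k + 1)})} {x} (hx : x ∈ X) (hx0 : x ≠ 0) :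
    Ideal.Quotient.mk _ (p ^ k) ∈ X := by
  have hkill : p ^ (k + 1) • x = 0 := by
    obtain ⟨b, rfl⟩ := Ideal.Quotient.mk_surjective x
    change Ideal.Quotient.mk (Ideal.span {p ^ (k + 1)}) (p ^ (k + 1) * b) = 0
    rw [Ideal.Quotient.eq_zero_iff_mem, Ideal.mem_span_singleton]
    exact ⟨b, rfl⟩
  obtain ⟨t, ht0, ht⟩ := exists_ne_zero_smul_eq_zero hx0 hkill
  obtain ⟨a, ha, hpa⟩ := mk_eq_of_smul_eq_zero hp0 ht
  obtain ⟨c, e, hce⟩ := exists_mul_eq_one_add hp (hpa ht0) 1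
  have h : Ideal.Quotient.mk (Ideal.span {p ^ (k + 1)}) (p ^ k) = c • t • x := by
    rw [ha]
    change _ = Ideal.Quotient.mk _ (c * (p ^ k * a))
    rw [Ideal.Quotient.eq, Ideal.mem_span_singleton]
    exact ⟨-e, by linear_combination (-p ^ k) * hce⟩
  rw [h]
  exact X.smul_mem _ (X.smul_mem _ hx)

end

section

variable {F A V U : Type*} [Field F] [CommRing A] [Algebra F A]
  [AddCommGroup V] [Module F V] [Module A V] [IsScalarTower F A V]
  [AddCommGroup U] [Module F U] [Module A U] [IsScalarTower F A U]
  {σ : A →ₐ[F] A} {B : LinearMap.BilinForm F V}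

omit [Algebra F A] [IsScalarTower F A U] in
theorem isometryCard_le_of_isScalarTower {R : Type*} [CommRing R] [Algebra A R] [Module R U]
    [IsScalarTower A R U] [Finite U] (β : LinearMap.BilinForm F U) :
    isometryCard R β ≤ isometryCard A β := by
  refine Nat.card_le_card_of_injective
    (fun h => ⟨h.1.restrictScalars A, h.2⟩) fun h h' hh => ?_
  refine Subtype.ext (LinearEquiv.ext fun x => ?_)
  exact LinearEquiv.congr_fun (Subtype.ext_iff.1 hh) x

/-- The radical of a pulled back form. -/
def radical (hB : IsSymplecticForm σ B) (i : U →ₗ[A] V) : Submodule A U where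
  carrier := {x | ∀ y, B (i x) (i y) = 0}
  add_mem' := fun {a b} ha hb y => by rw [map_add, map_add, LinearMap.add_apply, ha, hb, add_zero]
  zero_mem' := fun y => by simp
  smul_mem' := fun a x hx y => by rw [map_smul, hB.adj, ← map_smul]; exact hx _

theorem isSymplecticForm_pullback (hB : IsSymplecticForm σ B) (i : U →ₗ[A] V)
    (h : ∀ x ∈ radical hB i, x = 0) : IsSymplecticForm σ (pullbackForm B i) :=
  ⟨fun _ => hB.alt _, h, fun a x y => by
    rw [pullbackForm_apply, pullbackForm_apply, map_smul i, map_smul i, hB.adj]⟩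

theorem injective_of_isSymplecticForm_pullback {i : U →ₗ[A] V}
    (h : IsSymplecticForm σ (pullbackForm B i)) : Function.Injective i := by
  rw [injective_iff_map_eq_zero]
  exact fun x hx => h.nondeg x fun y => by rw [pullbackForm_apply, hx, map_zero,
    LinearMap.zero_apply]

theorem isSymplecticForm_quotient {I : Ideal A} (hI : I ≤ I.comap σ) {U : Type*} [AddCommGroup U]
    [Module F U] [Module A U] [Module (A ⧸ I) U] [IsScalarTower A (A ⧸ I) U]
    {β : LinearMap.BilinForm F U} (hβ : IsSymplecticForm σ β) :
    IsSymplecticForm (Ideal.quotientMapₐ I σ hI) β := by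
  refine ⟨hβ.alt, hβ.nondeg, fun r x y => ?_⟩
  obtain ⟨a, rfl⟩ := Ideal.Quotient.mk_surjective r
  have hmk : ∀ (a : A) (x : U), Ideal.Quotient.mk I a • x = a • x := fun a x => by
    rw [← Ideal.Quotient.algebraMap_eq, algebraMap_smul]
  have : Ideal.quotientMapₐ I σ hI (Ideal.Quotient.mk I a) = Ideal.Quotient.mk I (σ a) := rfl
  rw [this, hmk, hmk, hβ.adj]

end

section

variable {F A V : Type*} [Field F] [CommRing A] [Algebra F A]
  [AddCommGroup V] [Module F V] [Module A V] [IsScalarTower F A V]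
  {σ : A →ₐ[F] A} {B : LinearMap.BilinForm F V}

/-- A nontrivial symplectic module killed by a power of a self-dual prime has a nondegenerate
piece for which the centralizer bound holds. -/
theorem exists_nondegenerate_piece [Finite F] [Finite V] [IsDomain A]
    (hB : IsSymplecticForm σ B) (hσ : ∀ a, σ (σ a) = a) {p : A} (hp : (Ideal.span {p}).IsMaximal)
    (hp0 : p ≠ 0) (hpσ : p ∣ σ p) [Nontrivial V] {N : ℕ} (hN : ∀ x : V, p ^ N • x = 0) :
    ∃ (X : Submodule A V) (c u : ℕ), IsSymplecticForm σ (pullbackForm B X.subtype) ∧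
      1 < u ∧ u ≤ c ^ 2 ∧ Nat.card V = u * Nat.card X ∧
      c * isometryCard A (pullbackForm B X.subtype) ≤ isometryCard A B := by
  obtain ⟨k, hk, hk'⟩ := exists_exponent hN
  have hI : Ideal.span {p ^ (k + 1)} ≤ (Ideal.span {p ^ (k + 1)}).comap σ := by
    rw [Ideal.span_singleton_le_iff_mem, Ideal.mem_comap, map_pow, Ideal.mem_span_singleton]
    exact pow_dvd_pow_of_dvd hpσ _
  have : IsLocalRing (A ⧸ Ideal.span {p ^ (k + 1)}) := isLocalRing_quotient_pow hp k.succ_ne_zero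
  have hσ' : ∀ r, Ideal.quotientMapₐ _ σ hI (Ideal.quotientMapₐ _ σ hI r) = r := by
    intro r
    obtain ⟨a, rfl⟩ := Ideal.Quotient.mk_surjective r
    exact congrArg _ (hσ a)
  by_cases hcase : ∃ (v : V) (b : A), B (p ^ k • v) (b • v) ≠ 0
  · obtain ⟨v, b, hvb⟩ := hcase
    let i := quotientMap (hk v)
    have hi : IsSymplecticForm σ (pullbackForm B i) := by
      refine isSymplecticForm_pullback hB i fun x hx => ?_
      by_contra hx0
      exact hvb (mk_pow_mem_of_ne_bot hp hp0 hx hx0 (Ideal.Quotient.mk _ b))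
    have : Finite (A ⧸ Ideal.span {p ^ (k + 1)}) :=
      Finite.of_injective i (injective_of_isSymplecticForm_pullback hi)
    obtain ⟨X, hX, hcard, hle⟩ := exists_orthogonal_complement hB hσ i hi
    refine ⟨X, _, _, hX, Finite.one_lt_card, ?_, hcard, hle⟩
    exact (card_le_isometryCard_sq_of_cyclic hσ' (isSymplecticForm_quotient hI hi)).trans
      (Nat.pow_le_pow_left (isometryCard_le_of_isScalarTower _) 2)
  · push Not at hcase
    obtain ⟨v, hv⟩ := hk'
    obtain ⟨u, hu⟩ : ∃ u, B (p ^ k • v) u ≠ 0 := by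
      by_contra! h
      exact hv (hB.nondeg _ h)
    have hneg : B (p ^ k • u) v = -B (p ^ k • v) u := by
      have h := hcase (u + v) 1
      have h1 := hcase u 1
      have h2 := hcase v 1
      simp only [one_smul, smul_add, map_add, LinearMap.add_apply] at h h1 h2
      rw [h1, h2] at h
      linear_combination h
    let i := (quotientMap (hk v)).coprod (quotientMap (hk u))
    have himk : ∀ a b : A, i (Ideal.Quotient.mk _ a, Ideal.Quotient.mk _ b) = a • v + b • u :=
      fun a b => by simp [i]
    have hi : IsSymplecticForm σ (pullbackForm B i) := by
      refine isSymplecticForm_pullback hB i fun x hx => ?_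
      by_contra hx0
      have hkill : p ^ (k + 1) • x = 0 := by
        obtain ⟨x1, x2⟩ := x
        obtain ⟨a, rfl⟩ := Ideal.Quotient.mk_surjective x1
        obtain ⟨b, rfl⟩ := Ideal.Quotient.mk_surjective x2
        have h : ∀ b, p ^ (k + 1) • Ideal.Quotient.mk (Ideal.span {p ^ (k + 1)}) b = 0 := by
          intro b
          change Ideal.Quotient.mk (Ideal.span {p ^ (k + 1)}) (p ^ (k + 1) * b) = 0
          rw [Ideal.Quotient.eq_zero_iff_mem, Ideal.mem_span_singleton]
          exact ⟨b, rfl⟩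
        rw [Prod.smul_mk, h, h]
        rfl
      obtain ⟨t, ht0, ht⟩ := exists_ne_zero_smul_eq_zero hx0 hkill
      have htx := (radical hB i).smul_mem t hx
      generalize t • x = y at ht0 ht htx
      obtain ⟨y1, y2⟩ := y
      rw [Prod.smul_mk, Prod.mk_eq_zero] at ht
      obtain ⟨a, ha, hpa⟩ := mk_eq_of_smul_eq_zero hp0 ht.1
      obtain ⟨b, hb, hpb⟩ := mk_eq_of_smul_eq_zero hp0 ht.2
      have hrad : ∀ c d e : A, B ((c * (p ^ k * a)) • v + (c * (p ^ k * b)) • u)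
          (d • v + e • u) = 0 := by
        intro c d e
        have h := (radical hB i).smul_mem c htx (Ideal.Quotient.mk _ d, Ideal.Quotient.mk _ e)
        rw [himk, ha, hb, map_smul, himk, smul_add, smul_smul, smul_smul] at h
        exact h
      have hself : ∀ (w : V) (d : A), B ((d * p ^ k) • w) w = 0 := by
        intro w d
        rw [mul_smul, hB.adj]
        exact hcase _ _
      have hunit : ∀ (w : V) (c a e : A), c * a = 1 + e * p ^ (k + 1) →
          (c * (p ^ k * a)) • w = p ^ k • w := by
        intro w c a e h
        rw [show c * (p ^ k * a) = p ^ k + p ^ k * e * p ^ (k + 1) by linear_combination p ^ k * h,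
          add_smul, mul_smul, hk, smul_zero, add_zero]
      have hcomm : ∀ c b : A, c * (p ^ k * b) = (c * b) * p ^ k := fun c b => by ring
      rw [Ne, Prod.mk_eq_zero, not_and_or] at ht0
      rcases ht0 with h0 | h0
      · obtain ⟨c, e, hce⟩ := exists_mul_eq_one_add hp (hpa h0) (k + 1)
        have h := hrad c 0 1
        rw [hunit v c a e hce, hcomm, zero_smul, zero_add, one_smul, map_add,
          LinearMap.add_apply, hself, add_zero] at h
        exact hu h
      · obtain ⟨c, e, hce⟩ := exists_mul_eq_one_add hp (hpb h0) (k + 1)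
        have h := hrad c 1 0
        rw [hunit u c b e hce, hcomm, zero_smul, add_zero, one_smul, map_add,
          LinearMap.add_apply, hself, zero_add, hneg, neg_eq_zero] at h
        exact hu h
    have hfin : Finite ((A ⧸ Ideal.span {p ^ (k + 1)}) × (A ⧸ Ideal.span {p ^ (k + 1)})) :=
      Finite.of_injective i (injective_of_isSymplecticForm_pullback hi)
    have : Finite (A ⧸ Ideal.span {p ^ (k + 1)}) :=
      Finite.of_injective (fun r => (r, r)) fun _ _ h => (Prod.ext_iff.1 h).1
    obtain ⟨X, hX, hcard, hle⟩ := exists_orthogonal_complement hB hσ i hi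
    refine ⟨X, _, _, hX, Finite.one_lt_card, ?_, hcard, hle⟩
    rw [Nat.card_prod, ← sq]
    exact Nat.pow_le_pow_left ((card_le_isometryCard_of_rank_two hσ'
      (isSymplecticForm_quotient hI hi)).trans (isometryCard_le_of_isScalarTower _)) 2

/-- The centralizer bound for a module killed by a power of a self-dual prime. -/
theorem card_le_isometryCard_sq_of_primary {F A : Type*} [Field F] [CommRing A] [Algebra F A]
    [Finite F] [IsDomain A] {σ : A →ₐ[F] A} (hσ : ∀ a, σ (σ a) = a) {p : A}
    (hp : (Ideal.span {p}).IsMaximal) (hp0 : p ≠ 0) (hpσ : p ∣ σ p) (N m : ℕ) (V : Type*)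
    [AddCommGroup V] [Module F V] [Module A V] [IsScalarTower F A V] [Finite V]
    {B : LinearMap.BilinForm F V} (hB : IsSymplecticForm σ B) (hN : ∀ x : V, p ^ N • x = 0)
    (hm : Nat.card V ≤ m) : Nat.card V ≤ isometryCard A B ^ 2 := by
  induction m generalizing V with
  | zero => exact absurd hm (by simpa using Nat.card_pos.ne')
  | succ m ih =>
    rcases subsingleton_or_nontrivial V with hV | hV
    · rw [Nat.card_of_subsingleton (0 : V)]
      exact Nat.one_le_pow _ _ isometryCard_pos
    obtain ⟨X, c, u, hX, hu, huc, hcard, hle⟩ := exists_nondegenerate_piece hB hσ hp hp0 hpσ hN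
    have hXpos : 0 < Nat.card X := Nat.card_pos
    have h := ih X hX (fun x => Subtype.ext (hN x)) (by nlinarith)
    calc Nat.card V = u * Nat.card X := hcard
      _ ≤ c ^ 2 * isometryCard A (pullbackForm B X.subtype) ^ 2 := Nat.mul_le_mul huc h
      _ = (c * isometryCard A (pullbackForm B X.subtype)) ^ 2 := by ring
      _ ≤ _ := Nat.pow_le_pow_left hle 2

end

section

/-- In a finite module of exponent `p ^ (k + 1)`, the cyclic submodule generated by an element of
order `p ^ (k + 1)` is a retract. -/
theorem exists_retraction (F : Type*) {A W : Type*} [Field F] [Finite F] [CommRing A]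
    [Algebra F A] [IsDomain A] [AddCommGroup W] [Module F W] [Module A W] [IsScalarTower F A W]
    [Finite W] {p : A} (hp : (Ideal.span {p}).IsMaximal) (hp0 : p ≠ 0) {k : ℕ}
    (hk : ∀ x : W, p ^ (k + 1) • x = 0) {m : W} (hm : p ^ k • m ≠ 0) :
    ∃ c : W →ₗ[A] A ⧸ Ideal.span {p ^ (k + 1)}, c m = Ideal.Quotient.mk _ 1 := by
  obtain ⟨l, hl⟩ : ∃ l : Module.Dual F W, l (p ^ k • m) ≠ 0 := by
    by_contra! h
    exact hm ((Module.forall_dual_apply_eq_zero_iff F _).1 h)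
  let j := quotientMap (hk m)
  have hsep : ∀ r, (∀ a : A, l (a • j r) = 0) → r = 0 := by
    intro r hr
    by_contra hr0
    let X : Submodule A (A ⧸ Ideal.span {p ^ (k + 1)}) :=
      { carrier := {r | ∀ a : A, l (a • j r) = 0}
        add_mem' := fun {x y} hx hy a => by rw [map_add, smul_add, map_add, hx, hy, add_zero]
        zero_mem' := fun a => by simp
        smul_mem' := fun b x hx a => by rw [map_smul j, smul_smul]; exact hx _ }
    have h := mk_pow_mem_of_ne_bot (X := X) hp hp0 hr hr0 1
    rw [one_smul] at h
    exact hl h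
  have hjinj : Function.Injective j := by
    rw [injective_iff_map_eq_zero]
    exact fun r hr => hsep r fun a => by rw [hr, smul_zero, map_zero]
  have : Finite (A ⧸ Ideal.span {p ^ (k + 1)}) := Finite.of_injective j hjinj
  let θ : (A ⧸ Ideal.span {p ^ (k + 1)}) →ₗ[F] Module.Dual F (A ⧸ Ideal.span {p ^ (k + 1)}) :=
    (LinearMap.mul F _).compr₂ (l.comp (j.restrictScalars F))
  have hθ : ∀ r a, θ r (Ideal.Quotient.mk _ a) = l (a • j r) := by
    intro r a
    rw [← map_smul]
    change l (j (r * Ideal.Quotient.mk _ a)) = l (j (Ideal.Quotient.mk _ a * r))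
    rw [mul_comm]
  have hθinj : Function.Injective θ := by
    rw [injective_iff_map_eq_zero]
    exact fun r hr => hsep r fun a => by rw [← hθ, hr, LinearMap.zero_apply]
  have hθsurj : Function.Surjective θ :=
    (LinearMap.injective_iff_surjective_of_finrank_eq_finrank
      (Subspace.dual_finrank_eq (K := F) (V := A ⧸ Ideal.span {p ^ (k + 1)})).symm).1 hθinj
  have hrep : ∀ w : W, ∃ r, ∀ a : A, l (a • j r) = l (a • w) := by
    intro w
    obtain ⟨r, hr⟩ := hθsurj (l.comp ((quotientMap (hk w)).restrictScalars F))
    refine ⟨r, fun a => ?_⟩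
    rw [← hθ, hr]
    rfl
  choose c hc using hrep
  have huniq : ∀ w r, (∀ a : A, l (a • j r) = l (a • w)) → c w = r := by
    intro w r h
    refine sub_eq_zero.1 (hsep _ fun a => ?_)
    rw [map_sub, smul_sub, map_sub, hc, h, sub_self]
  refine ⟨⟨⟨c, fun x y => huniq _ _ fun a => ?_⟩, fun b x => huniq _ _ fun a => ?_⟩,
    huniq _ _ fun a => ?_⟩
  · rw [map_add, smul_add, smul_add, map_add, map_add, hc, hc]
  · rw [RingHom.id_apply, map_smul j, smul_smul, smul_smul]; exact hc _ _
  · rw [quotientMap_mk, one_smul]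

theorem card_mul_le_card_linearEquiv_mul (F : Type*) {A W : Type*} [Field F] [Finite F]
    [CommRing A] [Algebra F A] [IsDomain A] [AddCommGroup W] [Module F W] [Module A W]
    [IsScalarTower F A W] [Finite W] {p : A} (hp : (Ideal.span {p}).IsMaximal)
    (hp0 : p ≠ 0) [Nontrivial W] {N : ℕ} (hN : ∀ x : W, p ^ N • x = 0) :
    Finite (A ⧸ Ideal.span {p}) ∧ Nat.card (A ⧸ Ideal.span {p}) ≤ Nat.card W ∧
      Nat.card W * Nat.card (A ⧸ Ideal.span {p}) ≤
        Nat.card (W ≃ₗ[A] W) * Nat.card (A ⧸ Ideal.span {p}) + Nat.card W := by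
  obtain ⟨k, hk, m, hm⟩ := exists_exponent hN
  obtain ⟨c, hc⟩ := exists_retraction F hp hp0 hk hm
  have hle : Ideal.span {p ^ (k + 1)} ≤ Ideal.span {p} := by
    rw [Ideal.span_singleton_le_span_singleton]
    exact dvd_pow_self p k.succ_ne_zero
  let ψ : W →ₗ[A] A ⧸ Ideal.span {p} := (Submodule.factor hle).comp c
  have hψ : Function.Surjective ψ := by
    intro r
    obtain ⟨a, rfl⟩ := Ideal.Quotient.mk_surjective r
    refine ⟨a • m, ?_⟩
    rw [LinearMap.comp_apply, map_smul, hc]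
    change Ideal.Quotient.mk _ (a * 1) = _
    rw [mul_one]
  have hfin : Finite (A ⧸ Ideal.span {p}) := Finite.of_surjective ψ hψ
  refine ⟨hfin, Nat.card_le_card_of_surjective ψ hψ, ?_⟩
  have hker : Nat.card W = Nat.card (A ⧸ Ideal.span {p}) * Nat.card (LinearMap.ker ψ) := by
    rw [Submodule.card_eq_card_quotient_mul_card (LinearMap.ker ψ), mul_comm]
    congr 1
    exact Nat.card_congr (ψ.quotKerEquivOfSurjective hψ).toEquiv
  have hcompl : Nat.card (LinearMap.ker ψ) + Nat.card {x // ψ x ≠ 0} = Nat.card W := by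
    rw [← Set.ncard_add_ncard_compl (LinearMap.ker ψ : Set W)]
    rfl
  have haut : Nat.card {x // ψ x ≠ 0} ≤ Nat.card (W ≃ₗ[A] W) := by
    let f : W → W →ₗ[A] W := fun x => LinearMap.id + (quotientMap (hk (x - m))).comp c
    have hf : ∀ x, ψ x ≠ 0 → Function.Bijective (f x) := by
      intro x hx
      refine Finite.injective_iff_bijective.1 ((injective_iff_map_eq_zero _).2 fun w hw => ?_)
      obtain ⟨a, ha⟩ := Ideal.Quotient.mk_surjective (c x)
      obtain ⟨b, hb⟩ := Ideal.Quotient.mk_surjective (c w)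
      have hfw : f x w = w + b • (x - m) := by
        simp only [f, LinearMap.add_apply, LinearMap.id_apply, LinearMap.comp_apply, ← hb,
          quotientMap_mk]
      have hpa : ¬ p ∣ a := by
        intro h
        refine hx ?_
        rw [LinearMap.comp_apply, ← ha]
        exact Ideal.Quotient.eq_zero_iff_mem.2 (Ideal.mem_span_singleton.2 h)
      obtain ⟨d, e, hde⟩ := exists_mul_eq_one_add hp hpa (k + 1)
      rw [hfw] at hw
      have h := congrArg c hw
      rw [map_add, map_smul, map_sub, map_zero, hc, ← ha, ← hb, ← map_sub] at h
      have h' : Ideal.Quotient.mk (Ideal.span {p ^ (k + 1)}) (b + b * (a - 1)) = 0 := h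
      rw [Ideal.Quotient.eq_zero_iff_mem, Ideal.mem_span_singleton] at h'
      obtain ⟨t, ht⟩ := h'
      have hbx : b = p ^ (k + 1) * (d * t - b * e) := by linear_combination d * ht - b * hde
      rw [hbx, mul_comm, mul_smul, hk, smul_zero, add_zero] at hw
      exact hw
    refine Nat.card_le_card_of_injective
      (fun x : {x // ψ x ≠ 0} => LinearEquiv.ofBijective (f x) (hf x x.2)) fun x y hxy => ?_
    have hfm : ∀ x, f x m = x := by
      intro x
      simp only [f, LinearMap.add_apply, LinearMap.id_apply, LinearMap.comp_apply, hc,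
        quotientMap_mk, one_smul, add_sub_cancel]
    have := LinearEquiv.congr_fun hxy m
    rw [LinearEquiv.ofBijective_apply, LinearEquiv.ofBijective_apply, hfm, hfm] at this
    exact Subtype.ext this
  nlinarith

end

section

variable {F A V : Type*} [Field F] [CommRing A] [Algebra F A]
  [AddCommGroup V] [Module F V] [Module A V] [IsScalarTower F A V] [Finite F] [Finite V]
  {σ : A →ₐ[F] A} {B : LinearMap.BilinForm F V}

/-- If `ε` acts as a projection and `σ ε` as the complementary one, then the image `W` of `ε` is a
Lagrangian submodule each of whose automorphisms extends to an isometry. -/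
theorem card_linearEquiv_le_isometryCard (hB : IsSymplecticForm σ B) (hσ : ∀ a, σ (σ a) = a)
    {ε : A} (hε : ∀ x : V, ε • ε • x = ε • x) (hσε : ∀ x : V, σ ε • x = x - ε • x)
    (W : Submodule A V) (hW : ∀ x, x ∈ W ↔ ε • x = x) :
    Nat.card (W ≃ₗ[A] W) ≤ isometryCard A B ∧ Nat.card V = Nat.card W ^ 2 := by
  have hiso : ∀ x y, B (ε • x) (ε • y) = 0 := by
    intro x y
    rw [hB.adj, hσε, hε, sub_self, map_zero]
  constructor
  · let P : V →ₗ[A] W := (LinearMap.lsmul A V ε).codRestrict W fun x => (hW _).2 (hε x)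
    have hP : ∀ x, (P x : V) = ε • x := fun x => rfl
    have hPW : ∀ w : W, P w = w := fun w => Subtype.ext ((hW w).1 w.2)
    let E : (W ≃ₗ[A] W) → V →ₗ[A] V := fun f => W.subtype.comp (f.toLinearMap.comp P)
    have hE : ∀ f x, E f x = f (P x) := fun f x => rfl
    have hPε : ∀ x, P (ε • x) = P x := fun x => Subtype.ext (hε x)
    have hPE : ∀ f x, P (E f x) = f (P x) := fun f x => hPW _
    have hεE : ∀ f x, ε • E f x = E f x := fun f x => (hW _).1 (f (P x)).2
    choose D hD using fun f : W ≃ₗ[A] W => hB.exists_adjoint hσ (E f.symm)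
    have hεD : ∀ f y, ε • D f y = 0 := by
      intro f y
      have h : σ ε • D f y = D f y := by
        refine sub_eq_zero.1 (hB.nondeg_right _ fun x => ?_)
        rw [map_sub, ← hB.adj, ← hD, ← hD, hE, hE, hPε, sub_self]
      rw [hσε] at h
      simpa using h
    have hDD : ∀ f x y, B (D f x) (D f y) = 0 := by
      intro f x y
      rw [← hD, hE, ← hPε, hεD, map_zero, map_zero, Submodule.coe_zero, map_zero,
        LinearMap.zero_apply]
    have hED : ∀ f x y, B (E f x) (D f y) = B (ε • x) y := by
      intro f x y
      rw [← hD, hE, hPE, LinearEquiv.symm_apply_apply, hP]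
    let H : (W ≃ₗ[A] W) → V →ₗ[A] V := fun f => E f + D f
    have hH : ∀ f x y, B (H f x) (H f y) = B x y := by
      intro f x y
      have h1 : B (E f x) (E f y) = 0 := by rw [← hεE, ← hεE f y, hiso]
      have h2 := hB.adj (σ ε) x y
      rw [hσ, hσε, map_sub, LinearMap.sub_apply] at h2
      simp only [H, LinearMap.add_apply, map_add]
      rw [h1, hDD, hED, hB.neg_swap (D f x), hED, ← hB.neg_swap x (ε • y), ← h2]
      ring
    have hbij : ∀ f, Function.Bijective (H f) := by
      intro f
      refine Finite.injective_iff_bijective.1 ((injective_iff_map_eq_zero _).2 fun x hx => ?_)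
      exact hB.nondeg _ fun y => by rw [← hH f, hx, map_zero, LinearMap.zero_apply]
    refine Nat.card_le_card_of_injective
      (fun f => ⟨LinearEquiv.ofBijective (H f) (hbij f), hH f⟩) fun f f' h => ?_
    refine LinearEquiv.ext fun w => ?_
    have hw := LinearEquiv.congr_fun (Subtype.ext_iff.1 h) (w : V)
    have key : ∀ f, P (H f w) = f w := by
      intro f
      refine Subtype.ext ?_
      simp only [H, LinearMap.add_apply, map_add, hPE, hPW]
      rw [Submodule.coe_add, hP, hεD, add_zero]
    rw [← key f, ← key f']
    exact congrArg P hw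
  · let L : V →ₗ[A] V := LinearMap.lsmul A V ε
    have hL : ∀ x, L x = ε • x := fun x => rfl
    have hker : Nat.card V = Nat.card W * Nat.card (LinearMap.ker L) := by
      have hr : LinearMap.range L = W := by
        ext x
        rw [hW, LinearMap.mem_range]
        exact ⟨fun ⟨y, hy⟩ => by rw [← hy, hL, hε], fun h => ⟨x, h⟩⟩
      rw [Submodule.card_eq_card_quotient_mul_card (LinearMap.ker L), mul_comm, ← hr]
      congr 1
      exact Nat.card_congr L.quotKerEquivRange.toEquiv
    have h1 : Nat.card W ^ 2 ≤ Nat.card V := by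
      refine hB.card_sq_le_of_isotropic (S := W.restrictScalars F) fun x hx y hy => ?_
      rw [← (hW x).1 hx, ← (hW y).1 hy, hiso]
    have h2 : Nat.card (LinearMap.ker L) ^ 2 ≤ Nat.card V := by
      refine hB.card_sq_le_of_isotropic (S := (LinearMap.ker L).restrictScalars F)
        fun x hx y hy => ?_
      have hx' : ε • x = 0 := hx
      have hy' : ε • y = 0 := hy
      have h := hB.adj ε x y
      rw [hx', hσε, hy', sub_zero, map_zero, LinearMap.zero_apply] at h
      exact h.symm
    have hp1 : 0 < Nat.card W := Nat.card_pos
    have hp2 : 0 < Nat.card (LinearMap.ker L) := Nat.card_pos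
    rw [hker] at h1 h2 ⊢
    have h3 : Nat.card W ≤ Nat.card (LinearMap.ker L) := by nlinarith
    have h4 : Nat.card (LinearMap.ker L) ≤ Nat.card W := by nlinarith
    rw [le_antisymm h4 h3, sq]

/-- The centralizer bound for a module killed by a power of `p * σ p`, with `p` and `σ p`
coprime. -/
theorem card_mul_le_isometryCard_sq_of_split [IsDomain A] [Nontrivial V]
    (hB : IsSymplecticForm σ B) (hσ : ∀ a, σ (σ a) = a) {p : A}
    (hp : (Ideal.span {p}).IsMaximal) (hp0 : p ≠ 0) (hpσ : ¬ p ∣ σ p) {N : ℕ}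
    (hN : ∀ x : V, (p * σ p) ^ N • x = 0) :
    Finite (A ⧸ Ideal.span {p}) ∧ Nat.card (A ⧸ Ideal.span {p}) ^ 2 ≤ Nat.card V ∧
      (Nat.card V : ℝ) * (1 - 1 / (Nat.card (A ⧸ Ideal.span {p}) : ℝ)) ^ 2 ≤
        (isometryCard A B : ℝ) ^ 2 := by
  obtain ⟨u, v, huv⟩ : ∃ u v, u * p ^ N + v * σ p ^ N = 1 := by
    have h : IsCoprime p (σ p) := by
      obtain ⟨c, e, hce⟩ := exists_mul_eq_one_add hp hpσ 1
      exact ⟨-e, c, by linear_combination hce⟩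
    exact h.pow
  have hσuv : σ u * σ p ^ N + σ v * p ^ N = 1 := by
    have h := congrArg σ huv
    simpa only [map_add, map_mul, map_pow, hσ, map_one] using h
  have hN' : ∀ (x : V) (a : A), (a * (p ^ N * σ p ^ N)) • x = 0 := fun x a => by
    rw [← mul_pow, mul_smul, hN, smul_zero]
  let W : Submodule A V := Submodule.torsionBy A V (p ^ N)
  have hW : ∀ x, x ∈ W ↔ (v * σ p ^ N) • x = x := by
    intro x
    rw [Submodule.mem_torsionBy_iff]
    constructor
    · intro h
      rw [show v * σ p ^ N = 1 - u * p ^ N by linear_combination huv, sub_smul, mul_smul, h,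
        one_smul, smul_zero, sub_zero]
    · intro h
      rw [← h, smul_smul, ← hN' x v]
      congr 1
      ring
  obtain ⟨h1, h2⟩ := card_linearEquiv_le_isometryCard hB hσ (ε := v * σ p ^ N) (fun x => by
      rw [smul_smul, ← sub_eq_zero, ← sub_smul, ← neg_eq_zero, ← neg_smul, ← hN' x (u * v)]
      congr 1
      linear_combination -(v * σ p ^ N) * huv) (fun x => by
      rw [map_mul, map_pow, hσ]
      have h := hN' x (v * σ v - u * σ u)
      rw [show (v * σ v - u * σ u) * (p ^ N * σ p ^ N) = σ v * p ^ N + v * σ p ^ N - 1 by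
        linear_combination (-σ u * σ p ^ N) * huv - (1 - v * σ p ^ N) * hσuv, sub_smul, add_smul,
        one_smul] at h
      rwa [sub_eq_zero, ← eq_sub_iff_add_eq] at h) W hW
  have : Nontrivial W := by
    by_contra hW
    rw [not_nontrivial_iff_subsingleton] at hW
    rw [Nat.card_of_subsingleton (0 : W)] at h2
    exact absurd h2 (Finite.one_lt_card (α := V)).ne'
  obtain ⟨hfin, hQ, hle⟩ := card_mul_le_card_linearEquiv_mul F (W := W) (N := N) hp hp0
    fun x => Subtype.ext ((Submodule.mem_torsionBy_iff _ _).1 x.2)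
  refine ⟨hfin, by rw [h2]; exact Nat.pow_le_pow_left hQ 2, ?_⟩
  have hpos : (1 : ℝ) ≤ Nat.card (A ⧸ Ideal.span {p}) := by exact_mod_cast Nat.card_pos
  have hle' : (Nat.card W : ℝ) * Nat.card (A ⧸ Ideal.span {p}) ≤
      Nat.card (W ≃ₗ[A] W) * Nat.card (A ⧸ Ideal.span {p}) + Nat.card W := by exact_mod_cast hle
  have h1' : (Nat.card (W ≃ₗ[A] W) : ℝ) ≤ isometryCard A B := by exact_mod_cast h1
  rw [h2, Nat.cast_pow, ← mul_pow]
  have h3 : 1 / (Nat.card (A ⧸ Ideal.span {p}) : ℝ) ≤ 1 := by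
    rw [div_le_one (by linarith)]
    exact hpos
  refine pow_le_pow_left₀ (mul_nonneg (by positivity) (by linarith)) (le_trans ?_ h1') 2
  rw [one_sub_div (by linarith), mul_div_assoc', div_le_iff₀ (by linarith)]
  linarith

end

section

theorem isSymplecticForm_subtype {F A V : Type*} [Field F] [CommRing A] [Algebra F A]
    [AddCommGroup V] [Module F V] [Module A V] [IsScalarTower F A V] {σ : A →ₐ[F] A}
    {B : LinearMap.BilinForm F V} (hB : IsSymplecticForm σ B) {X Y : Submodule A V}
    (hXY : IsCompl X Y) (h : ∀ x : X, ∀ y : Y, B x y = 0) :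
    IsSymplecticForm σ (pullbackForm B X.subtype) := by
  refine ⟨fun x => hB.alt _, fun x hx => Subtype.ext (hB.nondeg _ fun z => ?_),
    fun a x y => hB.adj a x y⟩
  obtain ⟨⟨u, w⟩, rfl⟩ := (Submodule.prodEquivOfIsCompl X Y hXY).surjective z
  rw [Submodule.coe_prodEquivOfIsCompl', map_add, h, add_zero]
  exact hx u

theorem exists_prime_smul_eq_zero {A V : Type*} [CommRing A] [IsDomain A]
    [IsPrincipalIdealRing A] [Infinite A] [AddCommGroup V] [Module A V] [Finite V] [Nontrivial V] :
    ∃ p : A, p ≠ 0 ∧ (Ideal.span {p}).IsMaximal ∧ ∃ x : V, x ≠ 0 ∧ p • x = 0 := by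
  obtain ⟨I, hI⟩ := associatedPrimes.nonempty A V
  obtain ⟨hprime, x, rfl⟩ := isAssociatedPrime_iff.1 hI
  have hmem : ∀ a, a ∈ (⊥ : Submodule A V).colon {x} ↔ a • x = 0 := fun a => by
    rw [Submodule.mem_colon_singleton, Submodule.mem_bot]
  have hx : x ≠ 0 := by
    rintro rfl
    exact hprime.ne_top ((Ideal.eq_top_iff_one _).2 ((hmem 1).2 (smul_zero _)))
  obtain ⟨p, hp⟩ := IsPrincipalIdealRing.principal ((⊥ : Submodule A V).colon {x})
  rw [← Ideal.span] at hp
  have hp0 : p ≠ 0 := by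
    rintro rfl
    refine not_injective_infinite_finite (fun a : A => a • x) fun a b hab => ?_
    have h : a - b ∈ (⊥ : Submodule A V).colon {x} := by
      rw [hmem, sub_smul, sub_eq_zero]
      exact hab
    rw [hp, Ideal.mem_span_singleton, zero_dvd_iff] at h
    exact sub_eq_zero.1 h
  refine ⟨p, hp0, ?_, x, hx, ?_⟩
  · rw [← hp]
    refine IsPrime.to_maximal_ideal (hpi := hprime) ?_
    rw [hp, Ne, Ideal.span_singleton_eq_bot]
    exact hp0
  · rw [← hmem, hp]
    exact Ideal.mem_span_singleton_self p

/-- Fitting decomposition along an element invariant under the involution. -/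
theorem exists_fitting_decomposition {F A V : Type*} [Field F] [CommRing A] [Algebra F A]
    [AddCommGroup V] [Module F V] [Module A V] [IsScalarTower F A V] [Finite V] {σ : A →ₐ[F] A}
    {B : LinearMap.BilinForm F V} (hB : IsSymplecticForm σ B) {e : A} (he : σ e = e) :
    ∃ (X Y : Submodule A V) (N : ℕ), (∀ x : V, e • x = 0 → x ∈ X) ∧ (∀ x ∈ X, e ^ N • x = 0) ∧
      (∀ y ∈ Y, e • y = 0 → y = 0) ∧ IsSymplecticForm σ (pullbackForm B X.subtype) ∧
      IsSymplecticForm σ (pullbackForm B Y.subtype) ∧ Nat.card V = Nat.card X * Nat.card Y ∧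
      isometryCard A (pullbackForm B X.subtype) * isometryCard A (pullbackForm B Y.subtype) ≤
        isometryCard A B := by
  have : IsArtinian A V := isArtinian_of_finite
  let f : Module.End A V := LinearMap.lsmul A V e
  obtain ⟨N, hN⟩ := (f.eventually_isCompl_ker_pow_range_pow.and
    (Filter.eventually_ge_atTop 1)).exists
  obtain ⟨hc, hN1⟩ := hN
  have hf : ∀ x, (f ^ N) x = e ^ N • x := by
    intro x
    have : f ^ N = LinearMap.lsmul A V (e ^ N) := (map_pow (Module.toModuleEnd A V) e N).symm
    rw [this]
    rfl
  have hker : ∀ x, x ∈ LinearMap.ker (f ^ N) ↔ e ^ N • x = 0 := fun x => by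
    rw [LinearMap.mem_ker, hf]
  have hsub : ∀ x : V, e • x = 0 → x ∈ LinearMap.ker (f ^ N) := by
    intro x hx
    obtain ⟨t, rfl⟩ := Nat.exists_eq_add_of_le hN1
    rw [hker, pow_add, pow_one, mul_comm, mul_smul, hx, smul_zero]
  have horth : ∀ (x : LinearMap.ker (f ^ N)) (y : LinearMap.range (f ^ N)), B x y = 0 := by
    rintro ⟨x, hx⟩ ⟨_, y, rfl⟩
    have h := hB.adj (e ^ N) x y
    rw [(hker x).1 hx, map_zero, LinearMap.zero_apply, map_pow, he] at h
    change B x ((f ^ N) y) = 0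
    rw [hf]
    exact h.symm
  have horth' : ∀ (y : LinearMap.range (f ^ N)) (x : LinearMap.ker (f ^ N)), B y x = 0 :=
    fun y x => by rw [hB.neg_swap, horth, neg_zero]
  let E := Submodule.prodEquivOfIsCompl _ _ hc
  refine ⟨LinearMap.ker (f ^ N), LinearMap.range (f ^ N), N, hsub, fun x => (hker x).1,
    fun y hy hy0 => ?_, isSymplecticForm_subtype hB hc horth,
    isSymplecticForm_subtype hB hc.symm horth', ?_,
    isometryCard_mul_le _ _ E (fun _ _ => rfl) horth fun x y => horth' y x⟩
  · exact Submodule.disjoint_def.1 hc.disjoint y (hsub y hy0) hy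
  · rw [← Nat.card_prod]
    exact (Nat.card_congr E.toEquiv).symm

/-- The centralizer bound in terms of the maximal ideals in the support that are not self-dual. -/
theorem exists_finset_card_mul_le {F A : Type*} [Field F] [Finite F] [CommRing A]
    [Algebra F A] [IsDomain A] [IsPrincipalIdealRing A] [Infinite A] {σ : A →ₐ[F] A}
    (hσ : ∀ a, σ (σ a) = a) (m : ℕ) (V : Type*) [AddCommGroup V] [Module F V] [Module A V]
    [IsScalarTower F A V] [Finite V] {B : LinearMap.BilinForm F V} (hB : IsSymplecticForm σ B)
    (hm : Nat.card V ≤ m) :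
    ∃ S : Finset (Ideal A), (∀ I ∈ S, I.IsMaximal ∧ Finite (A ⧸ I)) ∧
      (∀ I ∈ S, I.comap σ ∉ S) ∧ (∀ I ∈ S, ∃ x : V, x ≠ 0 ∧ ∀ a ∈ I, a • x = 0) ∧
      (∏ I ∈ S, Nat.card (A ⧸ I)) ^ 2 ≤ Nat.card V ∧
      (Nat.card V : ℝ) * (∏ I ∈ S, (1 - 1 / (Nat.card (A ⧸ I) : ℝ))) ^ 2 ≤
        (isometryCard A B : ℝ) ^ 2 := by
  classical
  induction m generalizing V with
  | zero => exact absurd hm (by simpa using Nat.card_pos.ne')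
  | succ m ih =>
    rcases subsingleton_or_nontrivial V with hV | hV
    · refine ⟨∅, by simp, by simp, by simp, by simp, ?_⟩
      have h : 1 ≤ isometryCard A B := isometryCard_pos
      have h' : (1 : ℝ) ≤ isometryCard A B := by exact_mod_cast h
      rw [Nat.card_of_subsingleton (0 : V)]
      simpa using h'
    obtain ⟨p, hp0, hp, x, hx0, hx⟩ := exists_prime_smul_eq_zero (A := A) (V := V)
    obtain ⟨X, Y, N, hX, hXN, hY, hBX, hBY, hcard, hle⟩ :=
      exists_fitting_decomposition hB (e := p * σ p) (by rw [map_mul, hσ, mul_comm])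
    have hxX : x ∈ X := hX x (by rw [mul_comm, mul_smul, hx, smul_zero])
    have : Nontrivial X := ⟨⟨⟨x, hxX⟩, 0, fun h => hx0 (congrArg Subtype.val h)⟩⟩
    have hX1 : 1 < Nat.card X := Finite.one_lt_card
    have hY1 : 0 < Nat.card Y := Nat.card_pos
    obtain ⟨S, hS1, hS2, hS3, hS4, hS5⟩ := ih Y hBY (by nlinarith)
    have hle' : (isometryCard A (pullbackForm B X.subtype) : ℝ) ^ 2 *
        (isometryCard A (pullbackForm B Y.subtype) : ℝ) ^ 2 ≤ (isometryCard A B : ℝ) ^ 2 := by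
      rw [← mul_pow]
      exact pow_le_pow_left₀ (by positivity) (by exact_mod_cast hle) 2
    have hS3' : ∀ I ∈ S, ∃ x : V, x ≠ 0 ∧ ∀ a ∈ I, a • x = 0 := by
      intro I hI
      obtain ⟨y, hy0, hy⟩ := hS3 I hI
      exact ⟨y, by simpa using hy0, fun a ha => congrArg Subtype.val (hy a ha)⟩
    have hSp : ∀ I ∈ S, p * σ p ∉ I := by
      intro I hI hpI
      obtain ⟨y, hy0, hy⟩ := hS3 I hI
      exact hy0 (Subtype.ext (hY y y.2 (congrArg Subtype.val (hy _ hpI))))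
    by_cases hpσ : p ∣ σ p
    · have hXle : Nat.card X ≤ isometryCard A (pullbackForm B X.subtype) ^ 2 := by
        refine card_le_isometryCard_sq_of_primary hσ hp hp0 hpσ (2 * N) _ X hBX
          (fun y => ?_) le_rfl
        obtain ⟨t, ht⟩ : p * σ p ∣ p ^ 2 := by
          rw [sq]
          have := map_dvd σ hpσ
          rw [hσ] at this
          exact mul_dvd_mul_left p this
        rw [pow_mul, ht, mul_pow, mul_comm, mul_smul]
        rw [show (p * σ p) ^ N • y = 0 from Subtype.ext (hXN y y.2), smul_zero]
      have hXle' : (Nat.card X : ℝ) ≤ (isometryCard A (pullbackForm B X.subtype) : ℝ) ^ 2 := by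
        exact_mod_cast hXle
      refine ⟨S, hS1, hS2, hS3', ?_, ?_⟩
      · rw [hcard]
        nlinarith
      · rw [hcard, Nat.cast_mul, mul_assoc]
        exact (mul_le_mul hXle' hS5 (by positivity) (by positivity)).trans hle'
    · obtain ⟨hfin, hQ, hXle⟩ := card_mul_le_isometryCard_sq_of_split hBX hσ hp hp0 hpσ (N := N)
        fun y => Subtype.ext (hXN y y.2)
      have hpS : Ideal.span {p} ∉ S := fun h =>
        hSp _ h (Ideal.mul_mem_right _ _ (Ideal.mem_span_singleton_self p))
      refine ⟨insert (Ideal.span {p}) S, ?_, ?_, ?_, ?_, ?_⟩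
      · simp only [Finset.mem_insert, forall_eq_or_imp]
        exact ⟨⟨hp, hfin⟩, hS1⟩
      · simp only [Finset.mem_insert, forall_eq_or_imp, not_or]
        refine ⟨⟨fun h => hpσ ?_, fun h => hSp _ h ?_⟩, fun I hI => ⟨fun h => hSp I hI ?_,
          hS2 I hI⟩⟩
        · have : p ∈ (Ideal.span {p}).comap σ := by
            rw [h]
            exact Ideal.mem_span_singleton_self p
          exact Ideal.mem_span_singleton.1 this
        · refine Ideal.mul_mem_left _ _ ?_
          rw [Ideal.mem_comap, hσ]
          exact Ideal.mem_span_singleton_self p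
        · refine Ideal.mul_mem_left _ _ ?_
          rw [← Ideal.mem_comap, h]
          exact Ideal.mem_span_singleton_self p
      · simp only [Finset.mem_insert, forall_eq_or_imp]
        refine ⟨⟨x, hx0, fun a ha => ?_⟩, hS3'⟩
        obtain ⟨b, rfl⟩ := Ideal.mem_span_singleton.1 ha
        rw [mul_comm, mul_smul, hx, smul_zero]
      · rw [Finset.prod_insert hpS, mul_pow, hcard]
        exact Nat.mul_le_mul hQ hS4
      · rw [Finset.prod_insert hpS, mul_pow, hcard, Nat.cast_mul, mul_mul_mul_comm]
        exact (mul_le_mul hXle hS5 (by positivity) (by positivity)).trans hle'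

end

section

open LaurentPolynomial

theorem IsLocalization.isPrincipalIdealRing_of_isPrincipalIdealRing {R : Type*} (S : Type*)
    [CommRing R] [CommRing S] [Algebra R S] (M : Submonoid R) [IsLocalization M S]
    [IsPrincipalIdealRing R] : IsPrincipalIdealRing S := by
  refine ⟨fun I => ?_⟩
  obtain ⟨f, hf⟩ := IsPrincipalIdealRing.principal (I.under R)
  rw [← Ideal.span] at hf
  rw [← IsLocalization.map_under M S I, hf, Ideal.map_span, Set.image_singleton]
  exact ⟨_, rfl⟩

theorem LaurentPolynomial.isPrincipalIdealRing (F : Type*) [Field F] :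
    IsPrincipalIdealRing F[T;T⁻¹] :=
  IsLocalization.isPrincipalIdealRing_of_isPrincipalIdealRing F[T;T⁻¹]
    (Submonoid.powers (Polynomial.X : Polynomial F))

theorem LaurentPolynomial.infinite (F : Type*) [Field F] : Infinite F[T;T⁻¹] :=
  Infinite.of_injective _ (Polynomial.toLaurent_injective (R := F))

theorem LaurentPolynomial.algHom_ext_T {F K : Type*} [Field F] [CommRing K] [Algebra F K]
    {φ ψ : F[T;T⁻¹] →ₐ[F] K} (h : φ (T 1) = ψ (T 1)) : φ = ψ := by
  have hinv : ∀ χ : F[T;T⁻¹] →ₐ[F] K, χ (T 1) * χ (T (-1)) = 1 := fun χ => by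
    rw [← map_mul, ← T_add, add_neg_cancel, T_zero, map_one]
  have h' : φ (T (-1)) = ψ (T (-1)) := by
    have h1 := hinv φ
    have h2 := hinv ψ
    rw [h] at h1
    rw [← mul_one (φ (T (-1))), ← h2, ← mul_assoc, mul_comm (φ _), h1, one_mul]
  refine AlgHom.ext fun x => ?_
  induction x using LaurentPolynomial.induction_on with
  | h_C a => rw [C_eq_algebraMap, AlgHom.commutes, AlgHom.commutes]
  | h_add hp hq => rw [map_add, map_add, hp, hq]
  | h_C_mul_T n a ih => rw [T_add, ← mul_assoc, map_mul, map_mul ψ, ih, h]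
  | h_C_mul_T_Z n a ih => rw [sub_eq_add_neg, T_add, ← mul_assoc, map_mul, map_mul ψ, ih, h']

theorem LaurentPolynomial.card_filter_finrank_le {F : Type*} [Field F] [Finite F]
    {σ : F[T;T⁻¹] →ₐ[F] F[T;T⁻¹]} (hσ : ∀ a, σ (σ a) = a) (S : Finset (Ideal F[T;T⁻¹]))
    (hS : ∀ I ∈ S, I.IsMaximal ∧ Finite (F[T;T⁻¹] ⧸ I)) (hS' : ∀ I ∈ S, I.comap σ ∉ S) {k : ℕ}
    (hk : k ≠ 0) :
    2 * k * (S.filter fun I => Module.finrank F (F[T;T⁻¹] ⧸ I) = k).card ≤ Nat.card F ^ k := by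
  classical
  set U := S.filter fun I => Module.finrank F (F[T;T⁻¹] ⧸ I) = k with hU
  rcases U.eq_empty_or_nonempty with h | ⟨I₀, hI₀⟩
  · simp [h]
  have hmem : ∀ I : U, (I : Ideal F[T;T⁻¹]) ∈ S ∧ Module.finrank F (F[T;T⁻¹] ⧸ I.1) = k :=
    fun I => Finset.mem_filter.1 I.2
  let K := F[T;T⁻¹] ⧸ I₀
  have hI₀' := hmem ⟨I₀, hI₀⟩
  have : I₀.IsMaximal := (hS I₀ hI₀'.1).1
  have : Finite K := (hS I₀ hI₀'.1).2
  let : Field K := Ideal.Quotient.field I₀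
  have hcard : ∀ I : U, Nat.card ((F[T;T⁻¹] ⧸ I.1) →ₐ[F] K) = k := by
    intro I
    have : I.1.IsMaximal := (hS I (hmem I).1).1
    let : Field (F[T;T⁻¹] ⧸ I.1) := Ideal.Quotient.field I.1
    rw [FiniteField.natCard_algHom_of_finrank_dvd, (hmem I).2]
    exact dvd_of_eq ((hmem I).2.trans hI₀'.2.symm)
  let P := Bool × Σ I : U, ((F[T;T⁻¹] ⧸ I.1) →ₐ[F] K)
  let τ : Bool → (F[T;T⁻¹] →ₐ[F] F[T;T⁻¹]) := fun b => if b then σ else AlgHom.id F _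
  have hτ : ∀ b x, τ b (τ b x) = x := by
    intro b x
    cases b <;> simp [τ, hσ]
  let Φ : P → K := fun p => p.2.2 (Ideal.Quotient.mk p.2.1.1 (τ p.1 (T 1)))
  have hΦ : Function.Injective Φ := by
    rintro ⟨b, I, φ⟩ ⟨c, J, ψ⟩ h
    have hker : ∀ (b : Bool) (I : U) (φ : (F[T;T⁻¹] ⧸ I.1) →ₐ[F] K),
        RingHom.ker (φ.comp ((Ideal.Quotient.mkₐ F I.1).comp (τ b))) = I.1.comap (τ b) := by
      intro b I φ
      have : I.1.IsMaximal := (hS I (hmem I).1).1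
      let : Field (F[T;T⁻¹] ⧸ I.1) := Ideal.Quotient.field I.1
      ext x
      rw [RingHom.mem_ker, Ideal.mem_comap, ← Ideal.Quotient.eq_zero_iff_mem]
      exact map_eq_zero_iff φ φ.toRingHom.injective
    have hcomp : φ.comp ((Ideal.Quotient.mkₐ F I.1).comp (τ b)) =
        ψ.comp ((Ideal.Quotient.mkₐ F J.1).comp (τ c)) := algHom_ext_T h
    have hIJ : I.1.comap (τ b) = J.1.comap (τ c) := by rw [← hker b I φ, hcomp, hker]
    have hbc : b = c := by
      have hσσ : ∀ I : Ideal F[T;T⁻¹], (I.comap σ).comap σ = I := fun I => by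
        ext x
        simp [Ideal.mem_comap, hσ]
      have hid : ∀ I : Ideal F[T;T⁻¹], I.comap (AlgHom.id F F[T;T⁻¹]) = I := fun I => by
        ext x
        simp
      cases b <;> cases c <;> simp only [τ, reduceIte, Bool.false_eq_true, hid] at hIJ ⊢
      · exact (hS' J (hmem J).1 (hIJ ▸ (hmem I).1)).elim
      · exact (hS' I (hmem I).1 (hIJ ▸ (hmem J).1)).elim
    subst hbc
    have hIJ' : I = J := by
      refine Subtype.ext ?_
      ext x
      have := congrArg (fun L : Ideal F[T;T⁻¹] => τ b x ∈ L) hIJ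
      simpa only [Ideal.mem_comap, hτ, eq_iff_iff] using this
    subst hIJ'
    have : φ = ψ := by
      refine AlgHom.ext fun x => ?_
      obtain ⟨y, rfl⟩ := Ideal.Quotient.mk_surjective x
      have := DFunLike.congr_fun hcomp (τ b y)
      simpa [hτ] using this
    rw [this]
  have hfin : ∀ I : U, Finite ((F[T;T⁻¹] ⧸ I.1) →ₐ[F] K) := fun I =>
    Nat.finite_of_card_ne_zero (by rw [hcard I]; exact hk)
  have hle := Nat.card_le_card_of_injective Φ hΦ
  rw [Nat.card_prod, Nat.card_sigma, Finset.sum_congr rfl fun I _ => hcard I] at hle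
  have hK : Nat.card K = Nat.card F ^ k := by
    rw [← hI₀'.2, Module.natCard_eq_pow_finrank (K := F) (V := K)]
  rw [hK] at hle
  simpa [mul_assoc, mul_comm, mul_left_comm] using hle

end

section

open LaurentPolynomial Matrix

theorem sympJ_mul_self (n : ℕ) (F : Type*) [Field F] : sympJ n F * sympJ n F = -1 := by
  rw [sympJ, fromBlocks_multiply, ← fromBlocks_one, fromBlocks_neg]
  simp

/-- The action of Laurent polynomials on column vectors through an invertible matrix. -/
noncomputable def laurentEval {F ι : Type*} [Field F] [Fintype ι] [DecidableEq ι] (g : GL ι F) :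
    F[T;T⁻¹] →ₐ[F] Matrix ι ι F :=
  AddMonoidAlgebra.lift F (Matrix ι ι F) ℤ ((Units.coeHom _).comp (zpowersHom _ g))

theorem laurentEval_T {F ι : Type*} [Field F] [Fintype ι] [DecidableEq ι] (g : GL ι F) (n : ℤ) :
    laurentEval g (T n) = ((g ^ n : GL ι F) : Matrix ι ι F) := by
  rw [T, laurentEval, AddMonoidAlgebra.lift_single, one_smul]
  rfl

theorem transpose_laurentEval_mul_sympJ {F : Type*} [Field F] {n : ℕ} (g : Sp n F)
    (a : F[T;T⁻¹]) :
    (laurentEval g.1 a)ᵀ * sympJ n F = sympJ n F * laurentEval g.1 (invert a) := by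
  induction a using LaurentPolynomial.induction_on' with
  | add p q hp hq => simp only [map_add, transpose_add, add_mul, mul_add, hp, hq]
  | C_mul_T k a =>
    have h : ((g.1 ^ k : GL _ F) : Matrix _ _ F)ᵀ * sympJ n F *
      ((g.1 ^ k : GL _ F) : Matrix _ _ F) = sympJ n F := (Sp n F).zpow_mem g.2 k
    have h' : ((g.1 ^ k : GL _ F) : Matrix (Fin n ⊕ Fin n) (Fin n ⊕ Fin n) F) *
        ((g.1 ^ (-k) : GL _ F) : Matrix (Fin n ⊕ Fin n) (Fin n ⊕ Fin n) F) = 1 := by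
      rw [← Units.val_mul, ← _root_.zpow_add, add_neg_cancel, zpow_zero, Units.val_one]
    rw [← smul_eq_C_mul, map_smul, map_smul, map_smul, invert_T, laurentEval_T, laurentEval_T,
      transpose_smul, smul_mul_assoc, mul_smul_comm]
    congr 1
    calc _ = ((g.1 ^ k : GL _ F) : Matrix _ _ F)ᵀ * sympJ n F *
        (((g.1 ^ k : GL _ F) : Matrix _ _ F) * ((g.1 ^ (-k) : GL _ F) : Matrix _ _ F)) := by
          rw [h', mul_one]
      _ = _ := by rw [← mul_assoc, h]

/-- The module over Laurent polynomials defined by an invertible matrix. -/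
noncomputable abbrev laurentModule {F ι : Type*} [Field F] [Fintype ι] [DecidableEq ι]
    (g : GL ι F) : Module F[T;T⁻¹] (ι → F) :=
  Module.compHom (ι → F)
    ((Matrix.toLinAlgEquiv' (R := F) (n := ι)).toAlgHom.comp (laurentEval g)).toRingHom

/-- The bilinear form with matrix `sympJ`. -/
noncomputable def sympForm (n : ℕ) (F : Type*) [Field F] :
    LinearMap.BilinForm F (Fin n ⊕ Fin n → F) :=
  Matrix.toLinearMap₂' F (sympJ n F)

theorem sympForm_apply {n : ℕ} {F : Type*} [Field F] (x y : Fin n ⊕ Fin n → F) :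
    sympForm n F x y = x ⬝ᵥ sympJ n F *ᵥ y :=
  Matrix.toLinearMap₂'_apply' _ _ _

theorem isSymplecticForm_sympForm {F : Type*} [Field F] {n : ℕ} (g : Sp n F) :
    letI := laurentModule g.1
    IsSymplecticForm (invert (R := F)).toAlgHom (sympForm n F) := by
  let := laurentModule g.1
  refine ⟨fun x => ?_, fun x hx => ?_, fun a x y => ?_⟩
  · rw [sympForm_apply, ← Sum.elim_comp_inl_inr x, sympJ, fromBlocks_mulVec]
    simp [dotProduct, neg_mulVec, mul_comm]
  · refine dotProduct_eq_zero _ fun y => ?_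
    have h := hx (-(sympJ n F *ᵥ y))
    rwa [sympForm_apply, mulVec_neg, mulVec_mulVec, sympJ_mul_self, neg_mulVec, one_mulVec,
      neg_neg] at h
  · change sympForm n F (laurentEval g.1 a *ᵥ x) y =
      sympForm n F x (laurentEval g.1 (invert a) *ᵥ y)
    rw [sympForm_apply, sympForm_apply, mulVec_mulVec, ← transpose_laurentEval_mul_sympJ,
      ← mulVec_mulVec, dotProduct_mulVec x, vecMul_transpose]

theorem isometryCard_le_card_centralizer {F : Type*} [Field F] [Finite F] {n : ℕ} (g : Sp n F) :
    letI := laurentModule g.1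
    isometryCard F[T;T⁻¹] (sympForm n F) ≤
      Nat.card (Subgroup.centralizer ({g} : Set (Sp n F))) := by
  let := laurentModule g.1
  have hT : ∀ x : Fin n ⊕ Fin n → F, (T 1 : F[T;T⁻¹]) • x = (g.1 : Matrix _ _ F) *ᵥ x := by
    intro x
    change laurentEval g.1 (T 1) *ᵥ x = _
    rw [laurentEval_T, zpow_one]
  have hC : ∀ (c : F) (x : Fin n ⊕ Fin n → F), (C c : F[T;T⁻¹]) • x = c • x := by
    intro c x
    change laurentEval g.1 (C c) *ᵥ x = _
    rw [C_eq_algebraMap, AlgHom.commutes, Algebra.algebraMap_eq_smul_one, smul_mulVec, one_mulVec]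
  have hM : ∀ h : (Fin n ⊕ Fin n → F) ≃ₗ[F[T;T⁻¹]] (Fin n ⊕ Fin n → F),
      ∃ M : GL (Fin n ⊕ Fin n) F, ∀ x, (M : Matrix _ _ F) *ᵥ x = h x := by
    intro h
    let h' : (Fin n ⊕ Fin n → F) →ₗ[F] (Fin n ⊕ Fin n → F) :=
      { toFun := h
        map_add' := map_add h
        map_smul' := fun c x => by rw [RingHom.id_apply, ← hC, map_smul, hC] }
    have hinj : Function.Injective (LinearMap.toMatrix' h').mulVec := by
      intro x y hxy
      rw [← toLin'_apply, ← toLin'_apply, toLin'_toMatrix'] at hxy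
      exact h.injective hxy
    obtain ⟨u, hu⟩ := mulVec_injective_iff_isUnit.1 hinj
    refine ⟨u, fun x => ?_⟩
    rw [hu, ← toLin'_apply, toLin'_toMatrix']
    rfl
  choose M hM using hM
  have hext : ∀ N N' : GL (Fin n ⊕ Fin n) F,
      (∀ x, (N : Matrix (Fin n ⊕ Fin n) (Fin n ⊕ Fin n) F) *ᵥ x =
        (N' : Matrix (Fin n ⊕ Fin n) (Fin n ⊕ Fin n) F) *ᵥ x) → N = N' := fun N N' h =>
    Units.ext (Matrix.toLin'.injective (LinearMap.ext fun x => h x))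
  refine Nat.card_le_card_of_injective (fun h => ⟨⟨M h.1, ?_⟩, ?_⟩) fun h k hk => ?_
  · change (M h.1 : Matrix _ _ F)ᵀ * sympJ n F * (M h.1 : Matrix _ _ F) = sympJ n F
    refine (Matrix.toLinearMap₂' (R := F) (S₁ := F) (S₂ := F) (N₂ := F)).injective
      (LinearMap.ext fun x => LinearMap.ext fun y => ?_)
    have := h.2 x y
    rw [← hM, ← hM, sympForm_apply, sympForm_apply] at this
    rw [toLinearMap₂'_apply', toLinearMap₂'_apply', ← this, ← mulVec_mulVec, ← mulVec_mulVec,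
      dotProduct_mulVec x, vecMul_transpose]
  · rw [Subgroup.mem_centralizer_singleton_iff]
    refine Subtype.ext (hext _ _ fun x => ?_)
    simp only [Subgroup.coe_mul, Units.val_mul, ← mulVec_mulVec, hM, ← hT, map_smul]
  · have hMk : M h.1 = M k.1 := congrArg (fun z => z.1.1) hk
    refine Subtype.ext (LinearEquiv.ext fun x => ?_)
    rw [← hM, ← hM, hMk]

end

section

theorem exp_neg_add_sq_le_one_sub {x : ℝ} (h0 : 0 ≤ x) (h1 : x ≤ 1 / 2) :
    Real.exp (-(x + x ^ 2)) ≤ 1 - x := by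
  have h := Real.quadratic_le_exp_of_nonneg (x := x + x ^ 2) (by positivity)
  rw [Real.exp_neg, inv_le_iff_one_le_mul₀ (Real.exp_pos _)]
  refine le_trans ?_ (mul_le_mul_of_nonneg_left h (by linarith))
  have : 0 ≤ x ^ 2 * (1 - x - x ^ 2 - x ^ 3) := by
    refine mul_nonneg (sq_nonneg x) ?_
    have h2 : x ^ 2 ≤ 1 / 4 := by nlinarith
    have h3 : x ^ 3 ≤ 1 / 8 := by nlinarith
    linarith
  nlinarith

variable {ι : Type*} {S : Finset ι} {d : ι → ℕ} {q : ℕ}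

theorem sum_comp_le_of_card_fiber_le
    (hc : ∀ k, k ≠ 0 → 2 * k * (S.filter fun i => d i = k).card ≤ q ^ k)
    {T : Finset ι} (hT : T ⊆ S) (hd : ∀ i ∈ T, d i ≠ 0) {f : ℕ → ℝ} (hf : ∀ k, 0 ≤ f k) :
    ∑ i ∈ T, f (d i) ≤ ∑ k ∈ T.image d, (q : ℝ) ^ k * f k / (2 * k) := by
  rw [Finset.sum_comp f d]
  refine Finset.sum_le_sum fun k hk => ?_
  obtain ⟨i, hi, rfl⟩ := Finset.mem_image.1 hk
  have hk0 : (0 : ℝ) < d i := by exact_mod_cast Nat.pos_of_ne_zero (hd i hi)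
  have h1 : (T.filter fun j => d j = d i).card ≤ (S.filter fun j => d j = d i).card :=
    Finset.card_le_card (Finset.filter_subset_filter _ hT)
  have h2 : (2 * d i * (T.filter fun j => d j = d i).card : ℝ) ≤ q ^ d i := by
    exact_mod_cast (Nat.mul_le_mul_left _ h1).trans (hc _ (hd i hi))
  rw [nsmul_eq_mul, le_div_iff₀ (by positivity)]
  calc _ = (2 * d i * (T.filter fun j => d j = d i).card : ℝ) * f (d i) := by ring
    _ ≤ _ := mul_le_mul_of_nonneg_right h2 (hf _)

theorem sum_inv_pow_two_mul_le (hq : 2 ≤ q) (hd : ∀ i ∈ S, d i ≠ 0)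
    (hc : ∀ k, k ≠ 0 → 2 * k * (S.filter fun i => d i = k).card ≤ q ^ k) :
    ∑ i ∈ S, (1 / (q : ℝ) ^ d i) ^ 2 ≤ -Real.log (1 - 1 / q) / 2 := by
  have hq0 : (2 : ℝ) ≤ q := by exact_mod_cast hq
  have hr : |1 / (q : ℝ)| < 1 := by
    rw [abs_of_nonneg (by positivity), div_lt_one (by linarith)]
    linarith
  refine (sum_comp_le_of_card_fiber_le hc subset_rfl hd
    (f := fun k => (1 / (q : ℝ) ^ k) ^ 2) fun k => sq_nonneg _).trans ?_
  have hs := (Real.hasSum_pow_div_log_of_abs_lt_one hr).div_const 2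
  refine le_trans ?_ (sum_le_hasSum ((S.image d).image Nat.pred)
    (fun i _ => div_nonneg (div_nonneg (by positivity) (by positivity)) zero_le_two) hs)
  rw [Finset.sum_image (g := Nat.pred)]
  · refine Finset.sum_le_sum fun k hk => le_of_eq ?_
    obtain ⟨i, hi, rfl⟩ := Finset.mem_image.1 hk
    obtain ⟨m, hm⟩ := Nat.exists_eq_succ_of_ne_zero (hd i hi)
    rw [hm]
    simp only [Nat.succ_eq_add_one, Nat.pred_succ, Nat.cast_add, Nat.cast_one, one_div_pow]
    field_simp
  · intro a ha b hb hab
    obtain ⟨i, hi, rfl⟩ := Finset.mem_image.1 ha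
    obtain ⟨j, hj, rfl⟩ := Finset.mem_image.1 hb
    have := hd i hi
    have := hd j hj
    simp only [Nat.pred_eq_sub_one] at hab
    omega

theorem sum_inv_pow_le {n : ℕ} (hq : 2 ≤ q) (hn : 1 ≤ n) (hd : ∀ i ∈ S, d i ≠ 0)
    (hc : ∀ k, k ≠ 0 → 2 * k * (S.filter fun i => d i = k).card ≤ q ^ k)
    (hsum : ∑ i ∈ S, d i ≤ n) :
    ∑ i ∈ S, 1 / (q : ℝ) ^ d i ≤
      (1 + Real.log (Nat.log q (4 * n) : ℝ)) / 2 + 1 / 4 := by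
  set M := Nat.log q (4 * n) with hM
  have hq0 : (2 : ℝ) ≤ q := by exact_mod_cast hq
  rw [← Finset.sum_filter_add_sum_filter_not S fun i => d i ≤ M]
  refine add_le_add ?_ ?_
  · refine (sum_comp_le_of_card_fiber_le hc (Finset.filter_subset _ _)
      (fun i hi => hd i (Finset.mem_filter.1 hi).1)
      (f := fun k => 1 / (q : ℝ) ^ k) fun k => by positivity).trans ?_
    have h := harmonic_le_one_add_log M
    rw [harmonic_eq_sum_Icc] at h
    push_cast at h
    refine le_trans ?_ (div_le_div_of_nonneg_right h zero_le_two)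
    rw [Finset.sum_div]
    refine (Finset.sum_le_sum_of_subset_of_nonneg (t := Finset.Icc 1 M) ?_
      fun k _ _ => by positivity).trans (Finset.sum_le_sum fun k hk => le_of_eq ?_)
    · intro k hk
      obtain ⟨i, hi, rfl⟩ := Finset.mem_image.1 hk
      obtain ⟨hiS, hiM⟩ := Finset.mem_filter.1 hi
      exact Finset.mem_Icc.2 ⟨Nat.one_le_iff_ne_zero.2 (hd i hiS), hiM⟩
    · have : (0 : ℝ) < q := by linarith
      field_simp
  · have hlt : (4 * n : ℝ) < q ^ (M + 1) := by
      exact_mod_cast Nat.lt_pow_succ_log_self (by omega) (4 * n)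
    have hn' : (0 : ℝ) < n := by exact_mod_cast hn
    calc ∑ i ∈ S with ¬ d i ≤ M, 1 / (q : ℝ) ^ d i
        ≤ ∑ i ∈ S with ¬ d i ≤ M, (d i : ℝ) / (4 * n) := by
          refine Finset.sum_le_sum fun i hi => ?_
          obtain ⟨hiS, hiM⟩ := Finset.mem_filter.1 hi
          refine div_le_div₀ (by positivity) ?_ (by positivity) (hlt.le.trans ?_)
          · exact_mod_cast Nat.one_le_iff_ne_zero.2 (hd i hiS)
          · exact pow_le_pow_right₀ (by linarith) (by omega)
      _ ≤ ∑ i ∈ S, (d i : ℝ) / (4 * n) :=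
          Finset.sum_le_sum_of_subset_of_nonneg (Finset.filter_subset _ _)
            fun i _ _ => by positivity
      _ ≤ n / (4 * n) := by
          rw [← Finset.sum_div]
          exact div_le_div_of_nonneg_right (by exact_mod_cast hsum) (by positivity)
      _ = 1 / 4 := by field_simp

theorem sqrt_le_prod_one_sub_inv_pow {n : ℕ} (hq : 2 ≤ q) (hn : 1 ≤ n)
    (hd : ∀ i ∈ S, d i ≠ 0)
    (hc : ∀ k, k ≠ 0 → 2 * k * (S.filter fun i => d i = k).card ≤ q ^ k)
    (hsum : ∑ i ∈ S, d i ≤ n) :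
    Real.sqrt ((1 - 1 / (q : ℝ)) /
        (2 * Real.exp 1 * (Real.log (4 * (n : ℝ)) / Real.log (q : ℝ) + 4))) ≤
      ∏ i ∈ S, (1 - 1 / (q : ℝ) ^ d i) := by
  have hq0 : (2 : ℝ) ≤ q := by exact_mod_cast hq
  have hn' : (1 : ℝ) ≤ n := by exact_mod_cast hn
  have hlq : 0 < Real.log q := Real.log_pos (by linarith)
  have hr : 0 < 1 - 1 / (q : ℝ) := by
    rw [sub_pos, div_lt_one (by linarith)]
    linarith
  set M := Nat.log q (4 * n) with hM
  set L := Real.log (4 * (n : ℝ)) / Real.log (q : ℝ) with hL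
  have hML : (M : ℝ) ≤ L := by
    rw [hL, le_div_iff₀ hlq, ← Real.log_pow]
    refine Real.log_le_log (by positivity) ?_
    exact_mod_cast Nat.pow_log_le_self q (by omega : 4 * n ≠ 0)
  have hL0 : 0 ≤ L := (Nat.cast_nonneg M).trans hML
  have hlogM : Real.log M ≤ Real.log (L + 4) := by
    rcases Nat.eq_zero_or_pos M with h | h
    · rw [h, Nat.cast_zero, Real.log_zero]
      exact Real.log_nonneg (by linarith)
    · exact Real.log_le_log (by exact_mod_cast h) (by linarith)
  have hsmall : ∀ i ∈ S, 1 / (q : ℝ) ^ d i ≤ 1 / 2 := fun i hi => by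
    refine one_div_le_one_div_of_le two_pos (hq0.trans ?_)
    exact le_self_pow₀ (by linarith) (hd i hi)
  have hprod : Real.exp (-(∑ i ∈ S, 1 / (q : ℝ) ^ d i + ∑ i ∈ S, (1 / (q : ℝ) ^ d i) ^ 2)) ≤
      ∏ i ∈ S, (1 - 1 / (q : ℝ) ^ d i) := by
    rw [← Finset.sum_add_distrib, ← Finset.sum_neg_distrib, Real.exp_sum]
    exact Finset.prod_le_prod (fun i _ => (Real.exp_pos _).le)
      fun i hi => exp_neg_add_sq_le_one_sub (by positivity) (hsmall i hi)
  refine le_trans ?_ hprod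
  have h1 := sum_inv_pow_le hq hn hd hc hsum
  have h2 := sum_inv_pow_two_mul_le hq hd hc
  have hlog2 := Real.log_two_gt_d9
  have key : (1 - 1 / (q : ℝ)) / (2 * Real.exp 1 * (L + 4)) =
      Real.exp (Real.log (1 - 1 / q) - (Real.log 2 + 1 + Real.log (L + 4))) := by
    rw [Real.exp_sub, Real.exp_add, Real.exp_add, Real.exp_log hr, Real.exp_log two_pos,
      Real.exp_log (by linarith)]
  rw [key, Real.sqrt_le_left (Real.exp_pos _).le, ← Real.exp_nat_mul, Real.exp_le_exp]
  push_cast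
  linarith

end

/-- Theorem 6.13(1): every element of `Sp(2n,q)` has centralizer of order at least
`q^n [(1 - 1/q)/(2e (log_q(4n) + 4))]^{1/2}`. -/
theorem stmt_18 (F : Type*) [Field F] [Fintype F] (q n : ℕ)
    (hq : Fintype.card F = q) (hn : 1 ≤ n) (g : Sp n F) :
    (q : ℝ) ^ n * Real.sqrt ((1 - 1 / (q : ℝ)) /
        (2 * Real.exp 1 * (Real.log (4 * (n : ℝ)) / Real.log (q : ℝ) + 4))) ≤
      (Nat.card (Subgroup.centralizer ({g} : Set (Sp n F))) : ℝ) := by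
  have hcard : Nat.card F = q := by rw [Nat.card_eq_fintype_card, hq]
  have hq2 : 2 ≤ q := hcard ▸ Finite.one_lt_card
  have hV : Nat.card (Fin n ⊕ Fin n → F) = q ^ (2 * n) := by
    rw [Nat.card_fun, hcard, Nat.card_eq_fintype_card, Fintype.card_sum, Fintype.card_fin, two_mul]
  let := laurentModule g.1
  have : IsScalarTower F (LaurentPolynomial F) (Fin n ⊕ Fin n → F) := ⟨fun c a x => by
    change laurentEval g.1 (c • a) *ᵥ x = c • laurentEval g.1 a *ᵥ x
    rw [map_smul, Matrix.smul_mulVec]⟩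
  have := LaurentPolynomial.isPrincipalIdealRing F
  have := LaurentPolynomial.infinite F
  have hσ : ∀ a : LaurentPolynomial F, (LaurentPolynomial.invert (R := F)).toAlgHom
      ((LaurentPolynomial.invert (R := F)).toAlgHom a) = a :=
    fun a => LaurentPolynomial.involutive_invert a
  obtain ⟨S, hS, hS', -, hprod, hle⟩ :=
    exists_finset_card_mul_le hσ _ _ (isSymplecticForm_sympForm g) le_rfl
  let d : Ideal (LaurentPolynomial F) → ℕ := fun I => Module.finrank F (LaurentPolynomial F ⧸ I)
  have hquot : ∀ I ∈ S, Nat.card (LaurentPolynomial F ⧸ I) = q ^ d I := fun I hI => by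
    have := (hS I hI).2
    rw [Module.natCard_eq_pow_finrank (K := F), hcard]
  have hd : ∀ I ∈ S, d I ≠ 0 := fun I hI => by
    have := (hS I hI).2
    have : Nontrivial (LaurentPolynomial F ⧸ I) :=
      Ideal.Quotient.nontrivial_iff.2 (hS I hI).1.ne_top
    exact (Module.finrank_pos (R := F)).ne'
  have hsum : ∑ I ∈ S, d I ≤ n := by
    rw [Finset.prod_congr rfl hquot, Finset.prod_pow_eq_pow_sum, hV, ← pow_mul,
      Nat.pow_le_pow_iff_right hq2] at hprod
    omega
  have hsqrt := sqrt_le_prod_one_sub_inv_pow hq2 hn hd (fun k hk => by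
    rw [← hcard]
    exact LaurentPolynomial.card_filter_finrank_le hσ S hS hS' hk) hsum
  refine (mul_le_mul_of_nonneg_left hsqrt (by positivity)).trans
    (le_trans ?_ (Nat.cast_le.2 (isometryCard_le_card_centralizer g)))
  refine le_of_pow_le_pow_left₀ two_ne_zero (Nat.cast_nonneg _) (le_trans (le_of_eq ?_) hle)
  rw [hV, mul_pow, ← pow_mul, mul_comm n 2, Nat.cast_pow]
  congr 2
  exact Finset.prod_congr rfl fun I hI => by rw [hquot I hI, Nat.cast_pow]
end
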